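/- Let (R, m) be a complete Noetherian local ring, M a finite R-module of Krull dimension n ≥ 1, and T a non-empty proper subset of Assh_R(M); write Assh_R(M) \ T = {q_1, …, q_r}. Suppose for each i with 1 ≤ i ≤ r there is a prime Q_i ∈ Supp_R(M) with dim(R/Q_i) = 1, q_i ⊆ Q_i, and such that the intersection of all primes p ∈ T is not contained in Q_i. Then for the ideal a = Q_1 ∩ ⋯ ∩ Q_r one has Att_R(H^n_a(M)) = T. -/

import Mathlib

/-!
STATEMENT 2 (Dibaei–Jafari, Proposition 2.1, last assertion): with `Assh_R(M) \ T`
enumerated as `q_1, …, q_r` and with primes `Q_i ∈ Supp_R(M)` such that `dim(R/Q_i) = 1`,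
`q_i ⊆ Q_i` and `⋂_{p ∈ T} p ⊄ Q_i`, the ideal `a = Q_1 ∩ ⋯ ∩ Q_r` satisfies
`Att_R(H^n_a(M)) = T`.
-/

open CategoryTheory

noncomputable section

universe u

/-- A prime ideal `p` is an *attached prime* of the `R`-module `N` if `p` is the annihilator
of some quotient of `N`. -/
def attachedPrimes (R : Type u) [CommRing R] (N : Type u) [AddCommGroup N] [Module R N] :
    Set (Ideal R) :=
  { p | p.IsPrime ∧ ∃ K : Submodule R N, p = Module.annihilator R (N ⧸ K) }

/-- `Assh_R(M)`: the associated primes `p` of `M` with `dim (R ⧸ p) = dim M`, where the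
dimension of `M` is recorded by the natural number `n`. -/
def assh (R : Type u) [CommRing R] (M : Type u) [AddCommGroup M] [Module R M] (n : ℕ) :
    Set (Ideal R) :=
  { p ∈ associatedPrimes R M | ringKrullDim (R ⧸ p) = (n : WithBot (WithTop ℕ)) }

namespace LCpf
open Opposite Limits

section A
variable {R : Type u} [CommRing R] 

abbrev YF (Y : ModuleCat.{u} R) : ModuleCat.{u} R ⥤ (ModuleCat.{u} R)ᵒᵖ :=
  ((linearYoneda R (ModuleCat.{u} R)).obj Y).rightOp

abbrev GC {X : ModuleCat.{u} R} (P : ProjectiveResolution X) (Y : ModuleCat.{u} R) :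
    ChainComplex (ModuleCat.{u} R)ᵒᵖ ℕ :=
  ((YF Y).mapHomologicalComplex _).obj P.complex

variable {X : ModuleCat.{u} R} (P : ProjectiveResolution X) (Y : ModuleCat.{u} R)

/-- cocycles -/
abbrev cyc (n : ℕ) : ModuleCat.{u} R := ((GC P Y).opcycles n).unop

def icyc (n : ℕ) : cyc P Y n ⟶ ModuleCat.of R (P.complex.X n ⟶ Y) := ((GC P Y).pOpcycles n).unop

def pcyc (n : ℕ) : cyc P Y n ⟶ ((GC P Y).homology n).unop := ((GC P Y).homologyι n).unop

instance (n : ℕ) : Mono (icyc P Y n) :=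
  inferInstanceAs (Mono (Quiver.Hom.unop (X := (GC P Y).X n) (Y := (GC P Y).opcycles n) ((GC P Y).pOpcycles n)))
instance (n : ℕ) : Epi (pcyc P Y n) := by unfold pcyc; infer_instance

def icycL (n : ℕ) : cyc P Y n →ₗ[R] (P.complex.X n ⟶ Y) := (icyc P Y n).hom

lemma icyc_d (n : ℕ) (z : cyc P Y n) : P.complex.d (n+1) n ≫ (icycL P Y n z) = 0 := by
  have h := (GC P Y).d_pOpcycles (n+1) n
  have h2 := congrArg Quiver.Hom.unop h
  have h3 := congrArg (fun (f : cyc P Y n ⟶ ModuleCat.of R (P.complex.X (n+1) ⟶ Y)) => f.hom z) h2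
  exact h3

lemma icyc_surj (n : ℕ) (f : P.complex.X n ⟶ Y) (hf : P.complex.d (n+1) n ≫ f = 0) :
    ∃ z, icycL P Y n z = f := by
  let S : ShortComplex (ModuleCat.{u} R)ᵒᵖ := ShortComplex.mk _ _ ((GC P Y).d_pOpcycles (n+1) n)
  have hS : S.Exact := ShortComplex.exact_of_g_is_cokernel _
    ((GC P Y).opcyclesIsCokernel (n+1) n (by simp))
  have h2 := (ShortComplex.moduleCat_exact_iff _).1 hS.unop
  exact h2 f hf

lemma pcyc_ker (n : ℕ) (z : cyc P Y (n+1)) : (pcyc P Y (n+1)).hom z = 0 ↔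
    ∃ g : P.complex.X n ⟶ Y, P.complex.d (n+1) n ≫ g = icycL P Y (n+1) z := by
  let S : ShortComplex (ModuleCat.{u} R)ᵒᵖ := ShortComplex.mk _ _
    ((GC P Y).homologyι_comp_fromOpcycles (n+1) n)
  have hS : S.Exact := ShortComplex.exact_of_f_is_kernel _
    ((GC P Y).homologyIsKernel (n+1) n (by simp))
  have h2 := (ShortComplex.moduleCat_exact_iff _).1 hS.unop
  have key : ∀ g : P.complex.X n ⟶ Y, icycL P Y (n+1) (((GC P Y).fromOpcycles (n+1) n).unop.hom g) =
     P.complex.d (n+1) n ≫ g := by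
    intro g
    have h := (GC P Y).p_fromOpcycles (n+1) n
    have h2 := congrArg Quiver.Hom.unop h
    exact congrArg (fun (f : ModuleCat.of R (P.complex.X n ⟶ Y) ⟶ ModuleCat.of R (P.complex.X (n+1) ⟶ Y)) => f.hom g) h2
  constructor
  · intro h
    obtain ⟨g, hg⟩ := h2 z h
    refine ⟨g, ?_⟩
    exact (key g).symm.trans (congrArg _ hg)
  · rintro ⟨g, hg⟩
    have : z = (((GC P Y).fromOpcycles (n+1) n).unop.hom g) := by
      apply (ModuleCat.mono_iff_injective (icyc P Y (n+1))).1 inferInstance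
      exact hg.symm.trans (key g).symm
    rw [this]
    have h := S.zero
    have h2 := congrArg Quiver.Hom.unop h
    exact congrArg (fun (f : ModuleCat.of R (P.complex.X n ⟶ Y) ⟶ ((GC P Y).homology (n+1)).unop) => f.hom g) h2

/-- cocycle to Ext -/
def cycToExt (n : ℕ) : cyc P Y n →ₗ[R] Abelian.Ext X Y n where
  toFun z := P.extMk (icycL P Y n z) (n+1) rfl (icyc_d P Y n z)
  map_add' x y := by
    rw [P.add_extMk]; congr 1; simp
  map_smul' r x := by
    simp only [RingHom.id_apply]
    rw [Abelian.Ext.smul_eq_comp_mk₀, P.extMk_comp_mk₀]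
    congr 1
    simp

lemma cycToExt_surj (n : ℕ) : Function.Surjective (cycToExt P Y n) := by
  intro α
  obtain ⟨f, hf, h⟩ := P.extMk_surjective α (n+1) rfl
  obtain ⟨z, rfl⟩ := icyc_surj P Y n f hf
  exact ⟨z, h⟩

lemma ker_eq (n : ℕ) : LinearMap.ker (pcyc P Y (n+1)).hom = LinearMap.ker (cycToExt P Y (n+1)) := by
  ext z
  rw [LinearMap.mem_ker, LinearMap.mem_ker, pcyc_ker]
  exact (P.extMk_eq_zero_iff _ _ rfl (icyc_d P Y (n+1) z) n rfl).symm

lemma pcyc_surj (n : ℕ) : Function.Surjective (pcyc P Y n).hom :=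
  (ModuleCat.epi_iff_surjective _).1 inferInstance

def homEquiv (n : ℕ) : ((GC P Y).homology (n+1)).unop ≃ₗ[R] Abelian.Ext X Y (n+1) :=
  ((pcyc P Y (n+1)).hom.quotKerEquivOfSurjective (pcyc_surj P Y _)).symm ≪≫ₗ
  Submodule.quotEquivOfEq _ _ (ker_eq P Y n) ≪≫ₗ
  (cycToExt P Y (n+1)).quotKerEquivOfSurjective (cycToExt_surj P Y _)

lemma homEquiv_apply (n : ℕ) (z) : homEquiv P Y n ((pcyc P Y (n+1)).hom z) = cycToExt P Y (n+1) z := by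
  have : ((pcyc P Y (n+1)).hom.quotKerEquivOfSurjective (pcyc_surj P Y _)).symm ((pcyc P Y (n+1)).hom z)
      = Submodule.Quotient.mk z := by
    rw [LinearEquiv.symm_apply_eq]; rfl
  simp only [homEquiv, LinearEquiv.trans_apply, this]
  rfl

abbrev oldExt (X Y : ModuleCat.{u} R) (n : ℕ) : ModuleCat.{u} R :=
  ((_root_.Ext R (ModuleCat.{u} R) n).obj (op X)).obj Y

variable (X) in
def extEquiv (n : ℕ) : oldExt X Y (n+1) ≃ₗ[R] Abelian.Ext X Y (n+1) :=
  ((projectiveResolution X).isoLeftDerivedObj (YF Y) (n+1)).unop.toLinearEquiv.symm ≪≫ₗ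
    homEquiv (projectiveResolution X) Y n

lemma homEquiv_nat {X X' : ModuleCat.{u} R} (P : ProjectiveResolution X) (P' : ProjectiveResolution X')
    (g : X' ⟶ X) (φ : ProjectiveResolution.Hom P' P g)
    (n : ℕ) (x : ((GC P Y).homology (n+1)).unop) :
    homEquiv P' Y n ((((YF Y).mapHomologicalComplex _ ⋙ HomologicalComplex.homologyFunctor _ _ (n+1)).map φ.hom).unop.hom x) =
     (Abelian.Ext.mk₀ g).comp (homEquiv P Y n x) (zero_add _) := by
  obtain ⟨z, rfl⟩ := pcyc_surj P Y (n+1) x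
  rw [homEquiv_apply]
  let ψ := ((YF Y).mapHomologicalComplex (ComplexShape.down ℕ)).map φ.hom
  have h1 := HomologicalComplex.homologyι_naturality ψ (n+1)
  have h1' := congrArg (fun (f : cyc P Y (n+1) ⟶ ((GC P' Y).homology (n+1)).unop) => f.hom z) (congrArg Quiver.Hom.unop h1)
  have h2 := HomologicalComplex.p_opcyclesMap ψ (n+1)
  have h2' := congrArg (fun (f : cyc P Y (n+1) ⟶ ModuleCat.of R (P'.complex.X (n+1) ⟶ Y)) => f.hom z) (congrArg Quiver.Hom.unop h2)
  have h1'' : (HomologicalComplex.homologyMap ψ (n+1)).unop.hom ((pcyc P Y (n+1)).hom z) =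
    (pcyc P' Y (n+1)).hom ((HomologicalComplex.opcyclesMap ψ (n+1)).unop.hom z) := h1'
  have h2'' : icycL P' Y (n+1) ((HomologicalComplex.opcyclesMap ψ (n+1)).unop.hom z) = 
    φ.hom.f (n+1) ≫ icycL P Y (n+1) z := h2'
  refine Eq.trans (congrArg (homEquiv P' Y n) h1'') ?_
  rw [homEquiv_apply]
  refine Eq.trans ?_ (P.mk₀_comp_extMk (icycL P Y (n+1) z) (n+2) rfl (icyc_d P Y (n+1) z) φ).symm
  have gen : ∀ (f f' : P'.complex.X (n+1) ⟶ Y) (h : f = f') (a) (b),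
      P'.extMk f (n+2) rfl a = P'.extMk f' (n+2) rfl b := by
    rintro f _ rfl _ _; rfl
  exact gen _ _ h2'' (icyc_d P' Y (n+1) _) _

lemma extEquiv_nat {X X' : ModuleCat.{u} R} (g : X' ⟶ X) (n : ℕ) (x : oldExt X Y (n+1)) :
    extEquiv X' Y n ((((_root_.Ext R (ModuleCat.{u} R) (n+1)).map g.op).app Y).hom x) =
     (Abelian.Ext.mk₀ g).comp (extEquiv X Y n x) (zero_add _) := by
  let φ : ProjectiveResolution.Hom (projectiveResolution X') (projectiveResolution X) g :=
    { hom := ProjectiveResolution.lift g _ _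
      hom_f_zero_comp_π_f_zero := by
        simpa using (ProjectiveResolution.lift_commutes_zero g (projectiveResolution X') (projectiveResolution X)) }
  have h := ProjectiveResolution.isoLeftDerivedObj_inv_naturality g (projectiveResolution X') (projectiveResolution X)
    φ.hom φ.hom_f_zero_comp_π_f_zero (YF Y) (n+1)
  refine Eq.trans ?_ (homEquiv_nat Y _ _ g φ n _)
  refine congrArg (homEquiv (projectiveResolution X') Y n) ?_
  exact congrArg (fun (f : oldExt X Y (n+1) ⟶ ((GC (projectiveResolution X') Y).homology (n+1)).unop) => f.hom x) (congrArg Quiver.Hom.unop h)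
end A
end LCpf

namespace LCpf
open Opposite Limits

section A2
variable {R : Type u} [CommRing R]

/-- transition -/
def trQ (a : Ideal R) {k l : ℕ} (h : k ≤ l) : (R ⧸ a ^ l) →ₗ[R] (R ⧸ a ^ k) :=
  Submodule.mapQ _ _ LinearMap.id (Ideal.pow_le_pow_right h)

def extTr (a : Ideal R) (i : ℕ) (M : Type u) [AddCommGroup M] [Module R M] (k l : ℕ) (h : k ≤ l) :
    Abelian.Ext (ModuleCat.of R (R ⧸ a ^ k)) (ModuleCat.of R M) i →ₗ[R]
    Abelian.Ext (ModuleCat.of R (R ⧸ a ^ l)) (ModuleCat.of R M) i :=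
  Abelian.Ext.precompOfLinear (Abelian.Ext.mk₀ (ModuleCat.ofHom (trQ a h))) R _ (zero_add i)

lemma extTr_apply (a : Ideal R) (i : ℕ) (M : Type u) [AddCommGroup M] [Module R M] (k l : ℕ) (h : k ≤ l) (x) :
  extTr a i M k l h x = (Abelian.Ext.mk₀ (ModuleCat.ofHom (trQ a h))).comp x (zero_add i) := rfl

instance (a : Ideal R) (i : ℕ) (M : Type u) [AddCommGroup M] [Module R M] :
    DirectedSystem (fun k => Abelian.Ext (ModuleCat.of R (R ⧸ a ^ k)) (ModuleCat.of R M) i)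
      (extTr a i M · · ·) where
  map_self k x := by
    rw [extTr_apply]
    have : ModuleCat.ofHom (trQ a (le_refl k)) = 𝟙 _ := by
      ext
      simp [trQ]
    rw [this, Abelian.Ext.mk₀_id_comp]
  map_map k l m h1 h2 x := by
    simp only [extTr_apply]
    have : ModuleCat.ofHom (trQ a (h1.trans h2)) = ModuleCat.ofHom (trQ a h2) ≫ ModuleCat.ofHom (trQ a h1) := by
      ext
      simp [trQ]
    rw [this, Abelian.Ext.mk₀_comp_mk₀_assoc]

/-- local cohomology, elementwise model -/
def LC (a : Ideal R) (i : ℕ) (M : Type u) [AddCommGroup M] [Module R M] : Type u :=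
  Module.DirectLimit (fun k => Abelian.Ext (ModuleCat.of R (R ⧸ a ^ k)) (ModuleCat.of R M) i)
      (extTr a i M)

variable (a : Ideal R) (i : ℕ) (M : Type u) [AddCommGroup M] [Module R M]

instance : AddCommGroup (LC a i M) := inferInstanceAs (AddCommGroup (Module.DirectLimit _ _))
instance : Module R (LC a i M) := inferInstanceAs (Module R (Module.DirectLimit _ _))

def LC.of (k : ℕ) : Abelian.Ext (ModuleCat.of R (R ⧸ a ^ k)) (ModuleCat.of R M) i →ₗ[R] LC a i M :=
  Module.DirectLimit.of R ℕ _ (extTr a i M) k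

variable {a i M}
lemma LC.of_tr {k l : ℕ} (h : k ≤ l) (x) : LC.of a i M l (extTr a i M k l h x) = LC.of a i M k x :=
  Module.DirectLimit.of_f

lemma LC.exists_of (z : LC a i M) : ∃ k x, LC.of a i M k x = z := Module.DirectLimit.exists_of z

lemma LC.of_zero {k} {x} (h : LC.of a i M k x = 0) : ∃ l, ∃ hl : k ≤ l, extTr a i M k l hl x = 0 := by
  obtain ⟨l, hl, h⟩ := Module.DirectLimit.of.zero_exact h
  exact ⟨l, hl, h⟩

def LC.lift {P : Type*} [AddCommGroup P] [Module R P]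
   (g : ∀ k, Abelian.Ext (ModuleCat.of R (R ⧸ a ^ k)) (ModuleCat.of R M) i →ₗ[R] P)
   (Hg : ∀ k l hkl x, g l (extTr a i M k l hkl x) = g k x) : LC a i M →ₗ[R] P :=
  Module.DirectLimit.lift R ℕ _ (extTr a i M) g Hg

lemma LC.lift_of {P : Type*} [AddCommGroup P] [Module R P]
   (g : ∀ k, Abelian.Ext (ModuleCat.of R (R ⧸ a ^ k)) (ModuleCat.of R M) i →ₗ[R] P)
   (Hg : ∀ k l hkl x, g l (extTr a i M k l hkl x) = g k x) (k) (x) :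
   LC.lift g Hg (LC.of a i M k x) = g k x := Module.DirectLimit.lift_of _ _ _

variable (a i M)

abbrev oldD : ℕᵒᵖᵒᵖ ⥤ ModuleCat.{u} R :=
  localCohomology.diagram (localCohomology.idealPowersDiagram a) (i+1) ⋙
    (evaluation _ _).obj (ModuleCat.of R M)

def oldDEquiv (k : ℕ) : (oldD a i M).obj (op (op k)) ≃ₗ[R]
    Abelian.Ext (ModuleCat.of R (R ⧸ a ^ k)) (ModuleCat.of R M) (i+1) :=
  extEquiv (ModuleCat.of R (R ⧸ a ^ k)) (ModuleCat.of R M) i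

lemma oldDEquiv_nat {k l : ℕ} (h : k ≤ l) (f : (op (op k) : ℕᵒᵖᵒᵖ) ⟶ op (op l)) (x) :
    oldDEquiv a i M l (((oldD a i M).map f).hom x) =
    extTr a (i+1) M k l h (oldDEquiv a i M k x) :=
  extEquiv_nat (ModuleCat.of R M) (ModuleCat.ofHom (trQ a h)) i x

def toColim : LC a (i+1) M →ₗ[R] (colimit (oldD a i M) : ModuleCat.{u} R) :=
  LC.lift (fun k => (colimit.ι (oldD a i M) (op (op k))).hom ∘ₗ (oldDEquiv a i M k).symm.toLinearMap)
   (by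
    intro k l h x
    obtain ⟨y, rfl⟩ := (oldDEquiv a i M k).surjective x
    let f : (op (op k) : ℕᵒᵖᵒᵖ) ⟶ op (op l) := (homOfLE h).op.op
    rw [← oldDEquiv_nat a i M h f]
    simp only [LinearMap.comp_apply, LinearEquiv.coe_coe, LinearEquiv.symm_apply_apply]
    have := colimit.w (oldD a i M) f
    exact congrArg (fun (g : (oldD a i M).obj (op (op k)) ⟶ colimit (oldD a i M)) => g.hom y) this)

instance presOldD : PreservesColimit (oldD a i M) (forget (ModuleCat.{u} R)) := by
  have : PreservesFilteredColimitsOfSize.{0, 0} (forget (ModuleCat.{u} R)) :=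
    preservesFilteredColimitsOfSize_shrink.{0, u, 0, u} _
  have := PreservesFilteredColimitsOfSize.preserves_filtered_colimits (F := forget (ModuleCat.{u} R)) ℕᵒᵖᵒᵖ
  infer_instance

lemma toColim_bij : Function.Bijective (toColim a i M) := by
  constructor
  · rw [injective_iff_map_eq_zero]
    intro z hz
    obtain ⟨k, x, rfl⟩ := LC.exists_of z
    obtain ⟨y, rfl⟩ := (oldDEquiv a i M k).surjective x
    rw [toColim, LC.lift_of] at hz
    simp only [LinearMap.comp_apply, LinearEquiv.coe_coe, LinearEquiv.symm_apply_apply] at hz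
    have hz' : (colimit.ι (oldD a i M) (op (op k))) y = (colimit.ι (oldD a i M) (op (op k))) 0 := by
      rw [map_zero]; exact hz
    rw [Concrete.colimit_rep_eq_iff_exists] at hz'
    obtain ⟨l, f, g, hl⟩ := hz'
    have hkl : k ≤ l.unop.unop := f.unop.unop.down.down
    rw [← LC.of_tr hkl, ← oldDEquiv_nat a i M hkl f]
    have : (ConcreteCategory.hom ((oldD a i M).map f)) y = 0 := by rw [hl, map_zero]
    have e : ((oldD a i M).map f).hom y = 0 := this
    rw [e]; simp
  · intro z
    obtain ⟨j, y, rfl⟩ := Concrete.colimit_exists_rep (oldD a i M) z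
    refine ⟨LC.of a (i+1) M j.unop.unop (oldDEquiv a i M _ y), ?_⟩
    rw [toColim, LC.lift_of]
    simp only [LinearMap.comp_apply, LinearEquiv.coe_coe, LinearEquiv.symm_apply_apply]

/-- comparison -/
def cmpEquiv : (localCohomology a (i+1)).obj (ModuleCat.of R M) ≃ₗ[R] LC a (i+1) M :=
  (colimitObjIsoColimitCompEvaluation
    (localCohomology.diagram (localCohomology.idealPowersDiagram a) (i+1)) (ModuleCat.of R M)).toLinearEquiv
   ≪≫ₗ (LinearEquiv.ofBijective _ (toColim_bij a i M)).symm

end A2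
end LCpf

namespace LCpf
open Opposite Limits

section B1
variable {R : Type u} [CommRing R]
variable {a : Ideal R} {i : ℕ} {M N L : Type u} [AddCommGroup M] [Module R M]
 [AddCommGroup N] [Module R N] [AddCommGroup L] [Module R L]

variable (a i) in
def LC.map (f : M →ₗ[R] N) : LC a i M →ₗ[R] LC a i N :=
  LC.lift (fun k => LC.of a i N k ∘ₗ
    Abelian.Ext.postcompOfLinear (Abelian.Ext.mk₀ (ModuleCat.ofHom f)) R _ (add_zero i))
   (by
    intro k l h x
    simp only [LinearMap.comp_apply]
    rw [← LC.of_tr h]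
    congr 1
    simp only [extTr_apply]
    exact Abelian.Ext.comp_assoc _ _ _ _ (add_zero i) (by simp))

lemma LC.map_of (f : M →ₗ[R] N) (k : ℕ) (x) : LC.map a i f (LC.of a i M k x) =
    LC.of a i N k (x.comp (Abelian.Ext.mk₀ (ModuleCat.ofHom f)) (add_zero i)) := LC.lift_of _ _ _ _

lemma LC.map_id (z : LC a i M) : LC.map a i (LinearMap.id : M →ₗ[R] M) z = z := by
  obtain ⟨k, x, rfl⟩ := LC.exists_of z
  rw [LC.map_of]
  congr 1
  exact Abelian.Ext.comp_mk₀_id x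

lemma LC.map_comp (f : M →ₗ[R] N) (g : N →ₗ[R] L) (z : LC a i M) :
    LC.map a i (g ∘ₗ f) z = LC.map a i g (LC.map a i f z) := by
  obtain ⟨k, x, rfl⟩ := LC.exists_of z
  simp only [LC.map_of]
  congr 1
  rw [ModuleCat.ofHom_comp, ← Abelian.Ext.mk₀_comp_mk₀]
  exact (Abelian.Ext.comp_assoc _ _ _ _ _ (by simp)).symm

lemma LC.map_add (f g : M →ₗ[R] N) (z : LC a i M) :
    LC.map a i (f + g) z = LC.map a i f z + LC.map a i g z := by
  obtain ⟨k, x, rfl⟩ := LC.exists_of z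
  simp only [LC.map_of]
  rw [← _root_.map_add]
  congr 1
  rw [ModuleCat.ofHom_add, Abelian.Ext.mk₀_add, Abelian.Ext.comp_add]

lemma LC.map_smul (r : R) (f : M →ₗ[R] N) (z : LC a i M) :
    LC.map a i (r • f) z = r • LC.map a i f z := by
  obtain ⟨k, x, rfl⟩ := LC.exists_of z
  simp only [LC.map_of]
  rw [← _root_.map_smul]
  congr 1
  have : ModuleCat.ofHom (r • f) = r • ModuleCat.ofHom f := rfl
  rw [this, Abelian.Ext.mk₀_smul, Abelian.Ext.comp_smul]

lemma LC.map_zero (z : LC a i M) : LC.map a i (0 : M →ₗ[R] N) z = 0 := by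
  have := LC.map_smul (a := a) (i := i) (0 : R) (0 : M →ₗ[R] N) z
  simpa using this

lemma sexact {f : M →ₗ[R] N} {g : N →ₗ[R] L} (hf : Function.Injective f) (hg : Function.Surjective g)
    (h : Function.Exact f g) :
    ∃ _S : ShortComplex.ShortExact (ShortComplex.mk (ModuleCat.ofHom f) (ModuleCat.ofHom g)
      (by ext x; exact h.apply_apply_eq_zero x)), True := by
  refine ⟨?_, trivial⟩
  exact { exact := by
            rw [ShortComplex.moduleCat_exact_iff]
            intro x hx
            exact (h x).1 hx
          mono_f := (ModuleCat.mono_iff_injective _).2 hf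
          epi_g := (ModuleCat.epi_iff_surjective _).2 hg }

lemma LC.exact_mid {f : M →ₗ[R] N} {g : N →ₗ[R] L} (hf : Function.Injective f) (hg : Function.Surjective g)
    (h : Function.Exact f g) : Function.Exact (LC.map a i f) (LC.map a i g) := by
  intro z
  constructor
  · intro hz
    obtain ⟨k, x, rfl⟩ := LC.exists_of z
    rw [LC.map_of] at hz
    obtain ⟨l, hl, h0⟩ := LC.of_zero hz
    rw [extTr_apply] at h0
    obtain ⟨S, -⟩ := sexact hf hg h
    obtain ⟨y, hy⟩ := Abelian.Ext.covariant_sequence_exact₂ _ S (extTr a i N k l hl x) (by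
      rw [extTr_apply]
      exact (Abelian.Ext.comp_assoc _ _ _ _ _ (by simp)).trans h0)
    refine ⟨LC.of a i M l y, ?_⟩
    rw [LC.map_of, ← LC.of_tr hl]
    congr 1
  · rintro ⟨y, rfl⟩
    rw [← LC.map_comp]
    have : g ∘ₗ f = 0 := by ext x; exact h.apply_apply_eq_zero x
    rw [this, LC.map_zero]

lemma LC.exists_δ {f : M →ₗ[R] N} {g : N →ₗ[R] L} (hf : Function.Injective f) (hg : Function.Surjective g)
    (h : Function.Exact f g) : ∃ δ : LC a i L →ₗ[R] LC a (i+1) M,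
      Function.Exact (LC.map a i g) δ ∧ Function.Exact δ (LC.map a (i+1) f) := by
  obtain ⟨S, -⟩ := sexact hf hg h
  let δ : LC a i L →ₗ[R] LC a (i+1) M :=
    LC.lift (fun k => LC.of a (i+1) M k ∘ₗ
      Abelian.Ext.postcompOfLinear S.extClass R _ (rfl : i + 1 = i + 1))
     (by
      intro k l h x
      simp only [LinearMap.comp_apply]
      rw [← LC.of_tr h]
      congr 1
      simp only [extTr_apply]
      exact Abelian.Ext.comp_assoc _ _ _ _ rfl (by simp))
  have hδ : ∀ k x, δ (LC.of a i L k x) = LC.of a (i+1) M k (x.comp S.extClass rfl) :=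
    fun k x => LC.lift_of _ _ _ _
  refine ⟨δ, ?_, ?_⟩
  · intro z
    constructor
    · intro hz
      obtain ⟨k, x, rfl⟩ := LC.exists_of z
      rw [hδ] at hz
      obtain ⟨l, hl, h0⟩ := LC.of_zero hz
      rw [extTr_apply] at h0
      obtain ⟨y, hy⟩ := Abelian.Ext.covariant_sequence_exact₃ _ S (extTr a i L k l hl x) rfl (by
        rw [extTr_apply]
        exact (Abelian.Ext.comp_assoc _ _ _ _ _ (by simp)).trans h0)
      refine ⟨LC.of a i N l y, ?_⟩
      rw [LC.map_of, ← LC.of_tr hl]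
      congr 1
    · rintro ⟨y, rfl⟩
      obtain ⟨k, y, rfl⟩ := LC.exists_of y
      rw [LC.map_of, hδ]
      have : (y.comp (Abelian.Ext.mk₀ (ModuleCat.ofHom g)) (add_zero i)).comp S.extClass rfl = 0 := by
        refine (Abelian.Ext.comp_assoc _ _ _ _ (zero_add 1) (by simp)).trans ?_
        exact (congrArg (fun t => y.comp t rfl) S.comp_extClass).trans (Abelian.Ext.comp_zero _ _ _ _ _)
      rw [this, _root_.map_zero]
  · intro z
    constructor
    · intro hz
      obtain ⟨k, x, rfl⟩ := LC.exists_of z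
      rw [LC.map_of] at hz
      obtain ⟨l, hl, h0⟩ := LC.of_zero hz
      rw [extTr_apply] at h0
      obtain ⟨y, hy⟩ := Abelian.Ext.covariant_sequence_exact₁ _ S (extTr a (i+1) M k l hl x) (by
        rw [extTr_apply]
        exact (Abelian.Ext.comp_assoc _ _ _ _ _ (by simp)).trans h0) rfl
      refine ⟨LC.of a i L l y, ?_⟩
      rw [hδ, ← LC.of_tr hl]
      congr 1
    · rintro ⟨y, rfl⟩
      obtain ⟨k, y, rfl⟩ := LC.exists_of y
      rw [hδ, LC.map_of]
      have : (y.comp S.extClass rfl).comp (Abelian.Ext.mk₀ (ModuleCat.ofHom f)) (add_zero (i+1)) = 0 := by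
        refine (Abelian.Ext.comp_assoc _ _ _ _ (add_zero 1) (by simp)).trans ?_
        exact (congrArg (fun t => y.comp t rfl) S.extClass_comp).trans (Abelian.Ext.comp_zero _ _ _ _ _)
      rw [this, _root_.map_zero]

lemma LC.torsion (z : LC a i M) : ∃ k, ∀ r ∈ a ^ k, r • z = 0 := by
  obtain ⟨k, x, rfl⟩ := LC.exists_of z
  refine ⟨k, fun r hr => ?_⟩
  rw [← _root_.map_smul]
  have : r • x = 0 := by
    have h1 : (Abelian.Ext.mk₀ (r • 𝟙 (ModuleCat.of R (R ⧸ a ^ k)))).comp x (zero_add i) = r • x := by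
      rw [Abelian.Ext.mk₀_smul, Abelian.Ext.smul_comp, Abelian.Ext.mk₀_id_comp]
    rw [← h1]
    have : r • 𝟙 (ModuleCat.of R (R ⧸ a ^ k)) = 0 := by
      ext
      change r • (Ideal.Quotient.mk (a^k) 1) = 0
      rw [← Ideal.Quotient.mk_eq_mk, ← Submodule.Quotient.mk_smul]
      simpa [Ideal.Quotient.eq_zero_iff_mem] using hr
    rw [this, Abelian.Ext.mk₀_zero, Abelian.Ext.zero_comp]
  rw [this, _root_.map_zero]
end B1
end LCpf

namespace LCpf
open Opposite Limits

section B2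
variable {R : Type u} [CommRing R]
variable {a : Ideal R} {i : ℕ} {M N L : Type u} [AddCommGroup M] [Module R M]
 [AddCommGroup N] [Module R N] [AddCommGroup L] [Module R L]

variable (a M) in
/-- a-power torsion -/
def gam : Submodule R M where
  carrier := {m | ∃ k, ∀ r ∈ a ^ k, r • m = 0}
  zero_mem' := ⟨0, by simp⟩
  add_mem' := by
    rintro x y ⟨k, hk⟩ ⟨l, hl⟩
    refine ⟨k + l, fun r hr => ?_⟩
    rw [smul_add, hk r (Ideal.pow_le_pow_right (by simp) hr),
      hl r (Ideal.pow_le_pow_right (by simp) hr), add_zero]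
  smul_mem' := by
    rintro c x ⟨k, hk⟩
    refine ⟨k, fun r hr => ?_⟩
    rw [smul_comm, hk r hr, smul_zero]

lemma mem_gam {m : M} : m ∈ gam a M ↔ ∃ k, ∀ r ∈ a ^ k, r • m = 0 := Iff.rfl

def evk (k : ℕ) : Abelian.Ext (ModuleCat.of R (R ⧸ a ^ k)) (ModuleCat.of R M) 0 →ₗ[R] M where
  toFun x := (Abelian.Ext.linearEquiv₀ (R := R) x).hom (Submodule.Quotient.mk 1)
  map_add' x y := by simp
  map_smul' r x := by simp

lemma evk_mk₀ (k : ℕ) (f : ModuleCat.of R (R ⧸ a ^ k) ⟶ ModuleCat.of R M) :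
    evk k (Abelian.Ext.mk₀ f) = f.hom (Submodule.Quotient.mk 1) := by
  have : Abelian.Ext.linearEquiv₀ (R := R) (Abelian.Ext.mk₀ f) = f := by
    rw [← LinearEquiv.eq_symm_apply]; rfl
  simp [evk, this]

lemma exists_mk₀ {X Y : ModuleCat.{u} R} (x : Abelian.Ext X Y 0) : ∃ f, Abelian.Ext.mk₀ f = x :=
  ⟨_, Abelian.Ext.mk₀_linearEquiv₀_apply (R := R) x⟩

variable (a M) in
def LC.ev : LC a 0 M →ₗ[R] M := LC.lift (fun k => evk k) (by
    intro k l h x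
    obtain ⟨f, rfl⟩ := exists_mk₀ x
    rw [extTr_apply, Abelian.Ext.mk₀_comp_mk₀, evk_mk₀, evk_mk₀]
    rfl)

lemma LC.ev_of (k : ℕ) (f : ModuleCat.of R (R ⧸ a ^ k) ⟶ ModuleCat.of R M) : 
    LC.ev a M (LC.of a 0 M k (Abelian.Ext.mk₀ f)) = f.hom (Submodule.Quotient.mk 1) := by
  rw [LC.ev, LC.lift_of, evk_mk₀]

lemma LC.ev_inj : Function.Injective (LC.ev a M) := by
  rw [injective_iff_map_eq_zero]
  intro z hz
  obtain ⟨k, x, rfl⟩ := LC.exists_of z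
  obtain ⟨f, rfl⟩ := exists_mk₀ x
  rw [LC.ev_of] at hz
  have : f = 0 := by
    ext
    exact hz
  rw [this, Abelian.Ext.mk₀_zero, _root_.map_zero]

lemma LC.ev_map (f : M →ₗ[R] N) (z) : LC.ev a N (LC.map a 0 f z) = f (LC.ev a M z) := by
  obtain ⟨k, x, rfl⟩ := LC.exists_of z
  obtain ⟨g, rfl⟩ := exists_mk₀ x
  rw [LC.map_of, LC.ev_of, Abelian.Ext.mk₀_comp_mk₀, LC.ev_of]
  rfl

lemma LC.range_ev : LinearMap.range (LC.ev a M) = gam a M := by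
  ext m
  constructor
  · rintro ⟨z, rfl⟩
    obtain ⟨k, hk⟩ := LC.torsion z
    exact ⟨k, fun r hr => by rw [← _root_.map_smul, hk r hr, _root_.map_zero]⟩
  · rintro ⟨k, hk⟩
    refine ⟨LC.of a 0 M k (Abelian.Ext.mk₀ (ModuleCat.ofHom
      (Submodule.liftQ (a ^ k) (LinearMap.toSpanSingleton R M m) (by
        intro r hr
        simpa using hk r hr)))), ?_⟩
    rw [LC.ev_of]
    change Submodule.liftQ _ _ _ (Submodule.Quotient.mk 1) = m
    exact (Submodule.liftQ_apply _ _ _).trans (one_smul _ _)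

lemma inj_factor {I : Type u} [AddCommGroup I] [Module R I] [Module.Injective R I] (φ : M →ₗ[R] N) (f : M →ₗ[R] I)
    (h : LinearMap.ker φ ≤ LinearMap.ker f) : ∃ g : N →ₗ[R] I, ∀ x, g (φ x) = f x := by
  obtain ⟨g, hg⟩ := Module.Injective.out (R := R) (Q := I)
    ((LinearMap.ker φ).liftQ φ le_rfl) (by
      rw [← LinearMap.ker_eq_bot]; exact Submodule.ker_liftQ_eq_bot _ _ _ le_rfl)
    ((LinearMap.ker φ).liftQ f h)
  exact ⟨g, fun x => by simpa using hg (Submodule.Quotient.mk x)⟩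

lemma exists_inj (M : Type u) [AddCommGroup M] [Module R M] :
    ∃ (I : Type u) (_ : AddCommGroup I) (_ : Module R I) (_ : Module.Injective R I) (f : M →ₗ[R] I),
      Function.Injective f := by
  refine ⟨(Injective.under (ModuleCat.of R M) : ModuleCat.{u} R), inferInstance, inferInstance, ?_,
    (Injective.ι (ModuleCat.of R M)).hom, ?_⟩
  · have : CategoryTheory.Injective (ModuleCat.of R (Injective.under (ModuleCat.of R M) : ModuleCat.{u} R)) :=
      inferInstanceAs (CategoryTheory.Injective (Injective.under (ModuleCat.of R M)))
    exact Module.injective_module_of_injective_object R _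
  · exact (ModuleCat.mono_iff_injective _).1 inferInstance

lemma LC.inj_zero (I : Type u) [AddCommGroup I] [Module R I] [Module.Injective R I] :
    Subsingleton (LC a (i+1) I) := by
  refine subsingleton_of_forall_eq 0 fun z => ?_
  obtain ⟨k, x, rfl⟩ := LC.exists_of z
  have := Module.injective_object_of_injective_module R I
  rw [Abelian.Ext.eq_zero_of_injective x, _root_.map_zero]

lemma fg_tors [Module.Finite R M] (h : gam a M = ⊤) : ∃ c, ∀ r ∈ a ^ c, ∀ x : M, r • x = 0 := by
  obtain ⟨s, hs⟩ := Module.Finite.fg_top (R := R) (M := M)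
  choose f hf using fun x : M => (mem_gam.1 (h ▸ Submodule.mem_top : x ∈ gam a M))
  refine ⟨s.sup f, fun r hr x => ?_⟩
  have : x ∈ Submodule.span R (s : Set M) := hs ▸ Submodule.mem_top
  induction this using Submodule.span_induction with
  | mem x hx => exact hf x r (Ideal.pow_le_pow_right (Finset.le_sup hx) hr)
  | zero => simp
  | add x y _ _ h1 h2 => rw [smul_add, h1, h2, add_zero]
  | smul c x _ h => rw [smul_comm, h, smul_zero]

lemma gam_inj [IsNoetherianRing R] (I : Type u) [AddCommGroup I] [Module R I] [Module.Injective R I] :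
    Module.Injective R (gam a I) := by
  refine Module.Baer.injective ?_
  intro b f
  have : ∃ c, ∀ r ∈ a ^ c, ∀ x : b, r • f x = 0 := by
    have : Module.Finite R (LinearMap.range f) := inferInstance
    obtain ⟨c, hc⟩ := fg_tors (a := a) (M := LinearMap.range f) (by
      rw [eq_top_iff]
      rintro ⟨⟨y, k, hk⟩, hx⟩ -
      exact ⟨k, fun r hr => by ext; simpa using hk r hr⟩)
    refine ⟨c, fun r hr x => ?_⟩
    simpa [Subtype.ext_iff] using hc r hr ⟨f x, x, rfl⟩
  obtain ⟨c, hc⟩ := this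
  obtain ⟨k, hk⟩ := Ideal.exists_pow_inf_eq_pow_smul a (M := R) b
  have key : ∀ x : b, (x : R) ∈ a ^ (k + c) → f x = 0 := by
    rintro ⟨x, hx⟩ hxa
    have h1 : x ∈ a ^ (k+c) • (⊤ : Submodule R R) ⊓ b := ⟨by simpa using hxa, hx⟩
    rw [hk _ (by lia)] at h1
    have h2 : x ∈ a ^ c • (b : Submodule R R) := by
      have : k + c - k = c := by lia
      rw [this] at h1
      exact Submodule.smul_mono le_rfl inf_le_right h1
    have h3 : ∀ x ∈ a ^ c • (b : Submodule R R), ∀ hx : x ∈ b, f ⟨x, hx⟩ = 0 := by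
      intro x hx
      refine Submodule.smul_induction_on' hx ?_ ?_
      · intro r hr y hy h
        have : (⟨r • y, h⟩ : b) = r • ⟨y, hy⟩ := rfl
        rw [this, _root_.map_smul, hc r hr]
      · intro x hx y hy h1 h2 h
        have hx' : x ∈ b := Submodule.smul_le_right hx
        have hy' : y ∈ b := Submodule.smul_le_right hy
        have : (⟨x + y, h⟩ : b) = ⟨x, hx'⟩ + ⟨y, hy'⟩ := rfl
        rw [this, _root_.map_add, h1, h2, add_zero]
    exact h3 x h2 hx
  obtain ⟨g, hg⟩ := inj_factor (I := I) ((a ^ (k+c)).mkQ ∘ₗ b.subtype) ((gam a I).subtype ∘ₗ f) (by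
    intro x hx
    have : (x : R) ∈ a ^ (k+c) := by simpa [Ideal.Quotient.eq_zero_iff_mem] using hx
    simp [key x this])
  refine ⟨LinearMap.codRestrict _ (g ∘ₗ (a ^ (k+c)).mkQ) ?_, ?_⟩
  · intro x
    refine ⟨k + c, fun r hr => ?_⟩
    rw [← _root_.map_smul, LinearMap.comp_apply]
    have : (a ^ (k+c)).mkQ (r • x) = 0 := by
      exact (Submodule.Quotient.mk_eq_zero _).2 (Ideal.mul_mem_right x _ hr)
    rw [this, _root_.map_zero]
  · intro x hx
    ext
    exact hg ⟨x, hx⟩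

lemma LC.tors_vanish [IsNoetherianRing R] : ∀ (i : ℕ) (M : Type u) [AddCommGroup M] [Module R M],
    gam a M = ⊤ → Subsingleton (LC a (i+1) M) := by
  intro i
  induction i with
  | zero => 
    intro M _ _ h
    obtain ⟨I, _, _, _, f, hf⟩ := exists_inj (R := R) M
    have hfg : ∀ x, f x ∈ gam a I := by
      intro x
      obtain ⟨k, hk⟩ : x ∈ gam a M := h ▸ Submodule.mem_top
      exact ⟨k, fun r hr => by rw [← _root_.map_smul, hk r hr, _root_.map_zero]⟩
    have := gam_inj (a := a) I
    let f' : M →ₗ[R] gam a I := f.codRestrict _ hfg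
    have hf' : Function.Injective f' := fun x y hxy => hf (congrArg Subtype.val hxy)
    obtain ⟨δ, h1, h2⟩ := LC.exists_δ (a := a) (i := 0) hf' (Submodule.mkQ_surjective (LinearMap.range f'))
      (by rw [LinearMap.exact_iff]; simp)
    refine subsingleton_of_forall_eq 0 fun z => ?_
    have := LC.inj_zero (a := a) (i := 0) (gam a I)
    obtain ⟨y, rfl⟩ := (h2 z).1 (Subsingleton.elim _ _)
    refine (h1 y).2 ?_
    obtain ⟨⟨j, hj⟩, hj'⟩ := Submodule.mkQ_surjective _ (LC.ev a _ y)
    have : (⟨j, hj⟩ : gam a I) ∈ LinearMap.range (LC.ev a (gam a I)) := by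
      rw [LC.range_ev]
      obtain ⟨k, hk⟩ := hj
      exact ⟨k, fun r hr => by ext; exact hk r hr⟩
    obtain ⟨w, hw⟩ := this
    refine ⟨w, LC.ev_inj ?_⟩
    rw [LC.ev_map, hw, hj']
  | succ i ih =>
    intro M _ _ h
    obtain ⟨I, _, _, _, f, hf⟩ := exists_inj (R := R) M
    have hfg : ∀ x, f x ∈ gam a I := by
      intro x
      obtain ⟨k, hk⟩ : x ∈ gam a M := h ▸ Submodule.mem_top
      exact ⟨k, fun r hr => by rw [← _root_.map_smul, hk r hr, _root_.map_zero]⟩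
    have := gam_inj (a := a) I
    let f' : M →ₗ[R] gam a I := f.codRestrict _ hfg
    have hf' : Function.Injective f' := fun x y hxy => hf (congrArg Subtype.val hxy)
    obtain ⟨δ, h1, h2⟩ := LC.exists_δ (a := a) (i := i+1) hf' (Submodule.mkQ_surjective (LinearMap.range f'))
      (by rw [LinearMap.exact_iff]; simp)
    refine subsingleton_of_forall_eq 0 fun z => ?_
    have := LC.inj_zero (a := a) (i := i+1) (gam a I)
    obtain ⟨y, rfl⟩ := (h2 z).1 (Subsingleton.elim _ _)
    have := ih (gam a I ⧸ LinearMap.range f') (by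
      rw [eq_top_iff]
      rintro x -
      obtain ⟨⟨j, k, hk⟩, rfl⟩ := Submodule.mkQ_surjective _ x
      refine ⟨k, fun r hr => ?_⟩
      rw [← _root_.map_smul]
      have : r • (⟨j, k, hk⟩ : gam a I) = 0 := by ext; exact hk r hr
      rw [this, _root_.map_zero])
    rw [Subsingleton.elim y 0, _root_.map_zero]

end B2
end LCpf

namespace LCpf

section C1
variable {R : Type u} [CommRing R]
variable {M N L : Type u} [AddCommGroup M] [Module R M]
 [AddCommGroup N] [Module R N] [AddCommGroup L] [Module R L]

lemma zorn_sub (P : Submodule R M → Prop) (B : Submodule R M) (hB : P B)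
    (hc : ∀ c : Set (Submodule R M), (∀ s ∈ c, P s) → IsChain (· ≤ ·) c → c.Nonempty → P (sSup c)) :
    ∃ E, P E ∧ B ≤ E ∧ ∀ E', P E' → E ≤ E' → E' = E := by
  obtain ⟨E, hBE, hE⟩ := zorn_le_nonempty₀ {s | P s} (fun c hcs hch y hy =>
    ⟨sSup c, hc c hcs hch ⟨y, hy⟩, fun z hz => le_sSup hz⟩) B hB
  exact ⟨E, hE.prop, hBE, fun E' h1 h2 => (hE.eq_of_le h1 h2).symm⟩

lemma exists_hull (K0 : Submodule R M) [Module.Injective R M] : ∃ E : Submodule R M, K0 ≤ E ∧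
    Module.Injective R E ∧ ∀ x ∈ E, x ≠ 0 → ∃ r : R, r • x ∈ K0 ∧ r • x ≠ 0 := by
  obtain ⟨E, ⟨hE1, hE2⟩, -, hmax⟩ := zorn_sub (fun E : Submodule R M => K0 ≤ E ∧ ∀ x ∈ E, x ≠ 0 → ∃ r : R, r • x ∈ K0 ∧ r • x ≠ 0)
    K0 ⟨le_rfl, fun x hx h0 => ⟨1, by simpa, by simpa⟩⟩ (by
      rintro c h1 h2 ⟨y, hy⟩
      refine ⟨(h1 y hy).1.trans (le_sSup hy), fun x hx h0 => ?_⟩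
      obtain ⟨s, hs, hxs⟩ := (Submodule.mem_sSup_of_directed ⟨y, hy⟩ h2.directedOn).1 hx
      exact (h1 s hs).2 x hxs h0)
  obtain ⟨C, hC, -, hCmax⟩ := zorn_sub (fun C : Submodule R M => ∀ x ∈ C, x ∈ E → x = 0) ⊥ (by simp) (by
      rintro c h1 h2 ⟨y, hy⟩ x hx hxE
      obtain ⟨s, hs, hxs⟩ := (Submodule.mem_sSup_of_directed ⟨y, hy⟩ h2.directedOn).1 hx
      exact h1 s hs x hxs hxE)
  have hess : ∀ y, y ∉ C → ∃ r : R, ∃ e ∈ E, e ≠ 0 ∧ r • C.mkQ y = C.mkQ e := by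
    intro y hy
    by_contra! hcon
    have := hCmax (C ⊔ Submodule.span R {y}) (by
      intro x hx hxE
      obtain ⟨c, hc, z, hz, rfl⟩ := Submodule.mem_sup.1 hx
      obtain ⟨r, rfl⟩ := Submodule.mem_span_singleton.1 hz
      by_contra h0
      refine hcon r _ hxE h0 ?_
      rw [map_add, map_smul]
      simp [hc]) le_sup_left
    exact hy (this ▸ Submodule.mem_sup_right (Submodule.mem_span_singleton_self y))
  obtain ⟨ψ, hψ⟩ := inj_factor (I := M) (C.mkQ ∘ₗ E.subtype) E.subtype (by
    intro x hx
    have : (x : M) ∈ C := by simpa using hx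
    simpa using hC x this x.2)
  have hψ' : ∀ e ∈ E, ψ (C.mkQ e) = e := fun e he => hψ ⟨e, he⟩
  have hr : LinearMap.range ψ = E := by
    apply hmax
    · refine ⟨fun x hx => ⟨_, hψ' x (hE1 hx)⟩, ?_⟩
      rintro _ ⟨y, rfl⟩ h0
      obtain ⟨y, rfl⟩ := C.mkQ_surjective y
      obtain ⟨r, e, he, he0, hre⟩ := hess y (by
        intro hy
        apply h0
        have : C.mkQ y = 0 := by simpa
        rw [this, map_zero])
      obtain ⟨s, hs, hs0⟩ := hE2 e he he0
      have : (s * r) • ψ (C.mkQ y) = s • e := by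
        rw [mul_smul, ← map_smul, hre, hψ' e he]
      exact ⟨s * r, this ▸ hs, this ▸ hs0⟩
    · intro x hx
      exact ⟨_, hψ' x hx⟩
  refine ⟨E, hE1, ⟨?_⟩, hE2⟩
  intro X Y _ _ _ _ f hf g
  obtain ⟨h, hh⟩ := Module.Injective.out (R := R) f hf (E.subtype ∘ₗ g)
  refine ⟨LinearMap.codRestrict E (ψ ∘ₗ C.mkQ ∘ₗ h) (fun x => hr ▸ ⟨_, rfl⟩), fun x => ?_⟩
  ext
  simp only [LinearMap.codRestrict_apply, LinearMap.comp_apply, hh]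
  exact hψ' _ (g x).2

variable (R) in
lemma exists_E [IsNoetherianRing R] [IsLocalRing R] : ∃ (E : Type u) (_ : AddCommGroup E) (_ : Module R E) (_ : Module.Injective R E)
    (e : (R ⧸ IsLocalRing.maximalIdeal R) →ₗ[R] E), Function.Injective e ∧
      Module.Finite R ((R ⧸ IsLocalRing.maximalIdeal R) →ₗ[R] E) := by
  obtain ⟨I, _, _, _, f, hf⟩ := exists_inj (R := R) (R ⧸ IsLocalRing.maximalIdeal R)
  obtain ⟨E, hE1, hE2, hE3⟩ := exists_hull (LinearMap.range f)
  refine ⟨E, inferInstance, inferInstance, hE2, f.codRestrict E (fun x => hE1 ⟨x, rfl⟩), 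
    fun x y h => hf (congrArg Subtype.val h), ?_⟩
  have key : ∀ g : (R ⧸ IsLocalRing.maximalIdeal R) →ₗ[R] E, (g (Submodule.Quotient.mk 1) : I) ∈ LinearMap.range f := by
    intro g
    by_cases h0 : (g (Submodule.Quotient.mk 1) : I) = 0
    · rw [h0]; exact zero_mem _
    obtain ⟨r, hr, hr0⟩ := hE3 _ (g (Submodule.Quotient.mk 1)).2 h0
    have hu : IsUnit r := by
      by_contra hu
      apply hr0
      have : r • (Submodule.Quotient.mk 1 : R ⧸ IsLocalRing.maximalIdeal R) = 0 := by
        rw [← Submodule.Quotient.mk_smul, Submodule.Quotient.mk_eq_zero]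
        simpa using hu
      rw [← Submodule.coe_smul, ← map_smul, this]
      simp
    obtain ⟨u, rfl⟩ := hu
    have := Submodule.smul_mem _ (↑u⁻¹ : R) hr
    simpa [smul_smul] using this
  let φ : ((R ⧸ IsLocalRing.maximalIdeal R) →ₗ[R] E) →ₗ[R] LinearMap.range f :=
    { toFun := fun g => ⟨_, key g⟩
      map_add' := fun x y => by ext; simp
      map_smul' := fun r x => by ext; simp }
  refine Module.Finite.of_injective φ ?_
  rw [injective_iff_map_eq_zero]
  intro g hg
  have h2 : ((φ g : LinearMap.range f) : I) = 0 := by rw [hg]; rfl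
  have h3 : g (Submodule.Quotient.mk 1) = 0 := Subtype.ext h2
  ext
  exact congrArg Subtype.val h3

end C1
end LCpf

namespace LCpf

section C2
variable {R : Type u} [CommRing R]
variable {M N L E : Type u} [AddCommGroup M] [Module R M]
 [AddCommGroup N] [Module R N] [AddCommGroup L] [Module R L] [AddCommGroup E] [Module R E]

lemma prec_pi (I : Ideal R) [IsPrecomplete I R] (d : ℕ) : IsPrecomplete I (Fin d → R) := by
  have key : ∀ (n : ℕ) (x : Fin d → R), x ∈ (I ^ n • ⊤ : Submodule R (Fin d → R)) ↔ ∀ i, x i ∈ I ^ n := by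
    intro n x
    constructor
    · intro h i
      refine Submodule.smul_induction_on h ?_ ?_
      · intro r hr y _
        exact Ideal.mul_mem_right _ _ hr
      · intro a b ha hb
        exact add_mem ha hb
    · intro h
      rw [pi_eq_sum_univ x]
      exact Submodule.sum_mem _ fun i _ => Submodule.smul_mem_smul (h i) trivial
  refine ⟨fun f hf => ?_⟩
  have : ∀ i, ∃ l : R, ∀ n, f n i ≡ l [SMOD (I ^ n • ⊤ : Submodule R R)] := by
    intro i
    apply IsPrecomplete.prec ‹_›
    intro m n hmn
    have := hf hmn
    rw [SModEq.sub_mem, key] at this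
    rw [SModEq.sub_mem]
    simpa using this i
  choose l hl using this
  refine ⟨l, fun n => ?_⟩
  rw [SModEq.sub_mem, key]
  intro i
  have := hl i n
  rw [SModEq.sub_mem] at this
  simpa using this

lemma hom_mem_smul [IsNoetherianRing R] [Module.Injective R E] (J : Ideal R) (f : L →ₗ[R] E)
    (hf : ∀ x, (∀ r ∈ J, r • x = 0) → f x = 0) : f ∈ J • (⊤ : Submodule R (L →ₗ[R] E)) := by
  classical
  obtain ⟨s, hs⟩ := (IsNoetherian.noetherian J : J.FG)
  let φ : L →ₗ[R] (s → L) := LinearMap.pi (fun j => (j : R) • LinearMap.id)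
  obtain ⟨g, hg⟩ := inj_factor φ f (by
    intro x hx
    apply hf
    intro r hr
    rw [← hs] at hr
    refine Submodule.span_induction (p := fun r _ => r • x = 0) ?_ ?_ ?_ ?_ hr
    · intro r hr
      exact congrFun (LinearMap.mem_ker.1 hx) ⟨r, hr⟩
    · simp
    · intro a b _ _ ha hb; rw [add_smul, ha, hb, add_zero]
    · intro a b _ hb; rw [smul_assoc, hb, smul_zero])
  have : f = ∑ j : s, (j : R) • (g ∘ₗ LinearMap.single R (fun _ => L) j) := by
    ext x
    rw [← hg x]
    simp only [LinearMap.sum_apply, LinearMap.smul_apply, LinearMap.comp_apply]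
    simp only [← map_smul]
    rw [← map_sum]
    congr 1
    ext i
    simp [φ, Pi.single_apply]
  rw [this]
  exact Submodule.sum_mem _ fun j _ => Submodule.smul_mem_smul (hs ▸ Submodule.subset_span j.2) trivial

lemma smul_top_kill (J : Ideal R) (f : L →ₗ[R] E) (hf : f ∈ J • (⊤ : Submodule R (L →ₗ[R] E)))
    (x : L) (hx : ∀ r ∈ J, r • x = 0) : f x = 0 := by
  refine Submodule.smul_induction_on hf ?_ ?_
  · intro r hr y _
    rw [LinearMap.smul_apply, ← map_smul, hx r hr, map_zero]
  · intro a b ha hb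
    rw [LinearMap.add_apply, ha, hb, add_zero]

lemma hom_hausdorff (I : Ideal R) (h : gam I L = ⊤) : IsHausdorff I (L →ₗ[R] E) := by
  refine ⟨fun f hf => ?_⟩
  ext x
  obtain ⟨k, hk⟩ := mem_gam.1 (h ▸ Submodule.mem_top : x ∈ gam I L)
  have := hf k
  rw [SModEq.zero] at this
  exact smul_top_kill _ f this x hk

/-- annihilated submodule -/
def ann0 (J : Ideal R) (L : Type u) [AddCommGroup L] [Module R L] : Submodule R L where
  carrier := {x | ∀ r ∈ J, r • x = 0}
  add_mem' := fun ha hb r hr => by rw [smul_add, ha r hr, hb r hr, add_zero]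
  zero_mem' := fun r _ => smul_zero r
  smul_mem' := fun c x hx r hr => by rw [smul_comm, hx r hr, smul_zero]

lemma mem_ann0 {J : Ideal R} {x : L} : x ∈ ann0 J L ↔ ∀ r ∈ J, r • x = 0 := Iff.rfl

lemma hom_finite [IsNoetherianRing R] [Module.Injective R E] (I J : Ideal R) [IsPrecomplete I R]
    (hJ : J ≤ I) (h : gam I L = ⊤) (hfin : Module.Finite R (ann0 J L →ₗ[R] E)) :
    Module.Finite R (L →ₗ[R] E) := by
  have := hom_hausdorff (E := E) I h
  let ρ : (L →ₗ[R] E) →ₗ[R] (ann0 J L →ₗ[R] E) := LinearMap.lcomp R E (ann0 J L).subtype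
  have h1 : LinearMap.ker ρ ≤ I • (⊤ : Submodule R (L →ₗ[R] E)) := by
    intro f hf
    refine Submodule.smul_mono_left hJ (hom_mem_smul J f fun x hx => ?_)
    exact LinearMap.congr_fun (LinearMap.mem_ker.1 hf) ⟨x, hx⟩
  have h2 : Module.Finite R ((L →ₗ[R] E) ⧸ LinearMap.ker ρ) :=
    Module.Finite.of_injective _ (LinearMap.ker_eq_bot.1 (Submodule.ker_liftQ_eq_bot' _ ρ rfl))
  have h3 : Module.Finite R ((L →ₗ[R] E) ⧸ (I • (⊤ : Submodule R (L →ₗ[R] E)))) :=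
    Module.Finite.of_surjective (Submodule.factor h1) (Submodule.factor_surjective h1)
  obtain ⟨d, g, hg⟩ := Module.Finite.exists_fin' R ((L →ₗ[R] E) ⧸ (I • (⊤ : Submodule R (L →ₗ[R] E))))
  obtain ⟨φ, hφ⟩ := Module.projective_lifting_property (Submodule.mkQ (I • (⊤ : Submodule R (L →ₗ[R] E)))) g
    (Submodule.mkQ_surjective _)
  have := prec_pi I d
  exact Module.Finite.of_surjective φ (surjective_of_mkQ_comp_surjective (I := I) (by rw [hφ]; exact hg))

end C2

set_option linter.unusedSectionVars false
section C3
variable {R : Type u} [CommRing R] [IsNoetherianRing R] [IsLocalRing R]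
variable {M N L L' E : Type u} [AddCommGroup M] [Module R M] [AddCommGroup L'] [Module R L']
 [AddCommGroup N] [Module R N] [AddCommGroup L] [Module R L] [AddCommGroup E] [Module R E]
open IsLocalRing

variable (R E) in
/-- working notion of injective cogenerator -/
structure IsE : Prop where
  inj : Module.Injective R E
  emb : ∃ e : (R ⧸ maximalIdeal R) →ₗ[R] E, Function.Injective e
  fin : Module.Finite R ((R ⧸ maximalIdeal R) →ₗ[R] E)

/-- cofinite-type modules -/
structure Cof (R : Type u) [CommRing R] [IsLocalRing R] (E : Type u) [AddCommGroup E] [Module R E] (L : Type u) [AddCommGroup L] [Module R L] : Prop where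
  tors : gam (maximalIdeal R) L = ⊤
  fin : Module.Finite R (L →ₗ[R] E)

lemma gam_top_inj (a : Ideal R) (f : L' →ₗ[R] L) (hf : Function.Injective f) (h : gam a L = ⊤) : gam a L' = ⊤ := by
  rw [eq_top_iff]
  rintro x -
  obtain ⟨k, hk⟩ := mem_gam.1 (h ▸ Submodule.mem_top : f x ∈ gam a L)
  exact ⟨k, fun r hr => hf (by rw [map_smul, hk r hr, map_zero])⟩

lemma gam_top_surj (a : Ideal R) (f : L →ₗ[R] L') (hf : Function.Surjective f) (h : gam a L = ⊤) : gam a L' = ⊤ := by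
  rw [eq_top_iff]
  rintro y -
  obtain ⟨x, rfl⟩ := hf y
  obtain ⟨k, hk⟩ := mem_gam.1 (h ▸ Submodule.mem_top : x ∈ gam a L)
  exact ⟨k, fun r hr => (by rw [← map_smul, hk r hr, map_zero])⟩

lemma Cof.of_inj (hE : IsE R E) (f : L' →ₗ[R] L) (hf : Function.Injective f) (h : Cof R E L) : Cof R E L' := by
  have := hE.inj
  have := h.fin
  refine ⟨gam_top_inj _ f hf h.tors, Module.Finite.of_surjective (LinearMap.lcomp R E f) ?_⟩
  intro g
  obtain ⟨k, hk⟩ := Module.Injective.out (R := R) f hf g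
  exact ⟨k, LinearMap.ext hk⟩

lemma Cof.of_surj (f : L →ₗ[R] L') (hf : Function.Surjective f) (h : Cof R E L) : Cof R E L' := by
  have := h.fin
  refine ⟨gam_top_surj _ f hf h.tors, Module.Finite.of_injective (LinearMap.lcomp R E f) ?_⟩
  intro g g' hgg
  ext y
  obtain ⟨x, rfl⟩ := hf y
  exact LinearMap.congr_fun hgg x

lemma faithful (hE : IsE R E) (h : gam (maximalIdeal R) L = ⊤) (u : L) (hu : ∀ f : L →ₗ[R] E, f u = 0) : u = 0 := by
  have := hE.inj
  obtain ⟨e, he⟩ := hE.emb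
  by_contra h0
  obtain ⟨k, hk⟩ := mem_gam.1 (h ▸ Submodule.mem_top : u ∈ gam (maximalIdeal R) L)
  have key : ∃ r : R, r • u ≠ 0 ∧ ∀ s ∈ maximalIdeal R, s • r • u = 0 := by
    clear hu
    induction k generalizing u with
    | zero => exact absurd (by simpa using hk 1 (by simp)) h0
    | succ k ih =>
      by_cases hc : ∀ s ∈ maximalIdeal R, s • u = 0
      · exact ⟨1, by simpa using h0, by simpa using hc⟩
      · push Not at hc
        obtain ⟨s, hs, hs0⟩ := hc
        obtain ⟨r, hr, hr'⟩ := ih (s • u) hs0 (fun r hr => by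
          rw [smul_smul]; exact hk _ (by rw [pow_succ]; exact Ideal.mul_mem_mul hr hs))
        exact ⟨r * s, by rwa [mul_smul], by simpa only [mul_smul] using hr'⟩
  obtain ⟨r, hr, hr'⟩ := key
  let φ : (R ⧸ maximalIdeal R) →ₗ[R] L := (maximalIdeal R).liftQ (LinearMap.toSpanSingleton R L (r • u))
    (fun s hs => by simpa using hr' s hs)
  obtain ⟨f, hf⟩ := inj_factor φ e (by
    intro x hx
    induction x using Submodule.Quotient.induction_on with | _ s =>
    have hx' : s • r • u = 0 := hx
    have : s ∈ maximalIdeal R := by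
      by_contra hs
      have hs : IsUnit s := by simpa using hs
      exact hr ((hs.smul_eq_zero).1 hx')
    rw [(Submodule.Quotient.mk_eq_zero _).2 this]
    exact zero_mem _)
  have h1 := hf (Submodule.Quotient.mk 1)
  have h2 : φ (Submodule.Quotient.mk 1) = r • u := one_smul R (r • u)
  rw [h2, map_smul, hu f, smul_zero] at h1
  have h3 := he (h1.symm.trans (map_zero e).symm)
  rw [Submodule.Quotient.mk_eq_zero] at h3
  exact (maximalIdeal.isMaximal R).ne_top ((Ideal.eq_top_iff_one _).2 h3)

variable [IsPrecomplete (maximalIdeal R) R]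

lemma Cof.of_fg (hE : IsE R E) [Module.Finite R L] (h : gam (maximalIdeal R) L = ⊤) : Cof R E L := by
  have := hE.inj
  have := hE.fin
  refine ⟨h, hom_finite _ _ le_rfl h ?_⟩
  obtain ⟨d, g, hg⟩ := Module.Finite.exists_fin' R (ann0 (maximalIdeal R) L)
  let ψ : (ann0 (maximalIdeal R) L →ₗ[R] E) →ₗ[R] (Fin d → ((R ⧸ maximalIdeal R) →ₗ[R] E)) :=
    LinearMap.pi (fun i => LinearMap.lcomp R E ((maximalIdeal R).liftQ (LinearMap.toSpanSingleton R _ (g (Pi.single i 1)))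
      (fun s hs => by
        simp only [LinearMap.mem_ker, LinearMap.toSpanSingleton_apply]
        exact Subtype.ext ((g (Pi.single i 1)).2 s hs))))
  refine Module.Finite.of_injective ψ ?_
  rw [injective_iff_map_eq_zero]
  intro f hf
  have : f ∘ₗ g = 0 := by
    ext i
    have := LinearMap.congr_fun (congrFun hf i) (Submodule.Quotient.mk 1)
    have h5 : f ((1 : R) • g (Pi.single i 1)) = 0 := this
    rw [one_smul] at h5
    simpa using h5
  ext x
  obtain ⟨y, hy⟩ := hg x
  rw [← hy]
  exact LinearMap.congr_fun this y

lemma Cof.of_ann (hE : IsE R E) (x : R) (hx : x ∈ maximalIdeal R) (ht : ∀ u : L, ∃ k : ℕ, x ^ k • u = 0)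
    (h : Cof R E (ann0 (Ideal.span {x}) L)) : Cof R E L := by
  have := hE.inj
  have h1 : gam (maximalIdeal R) L = ⊤ := by
    rw [eq_top_iff]
    rintro u -
    obtain ⟨k, hk⟩ := ht u
    induction k generalizing u with
    | zero => rw [pow_zero, one_smul] at hk; rw [hk]; exact zero_mem _
    | succ k ih =>
      obtain ⟨c, hc⟩ := mem_gam.1 (ih (u := x • u) (by rw [smul_smul, ← pow_succ, hk]))
      let φ : (maximalIdeal R ^ c : Ideal R) →ₗ[R] ann0 (Ideal.span {x}) L :=
        LinearMap.codRestrict _ ((LinearMap.toSpanSingleton R L u) ∘ₗ (maximalIdeal R ^ c : Ideal R).subtype) (by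
          rintro ⟨r, hr⟩ s hs
          obtain ⟨t, rfl⟩ := Ideal.mem_span_singleton'.1 hs
          simp only [LinearMap.comp_apply, Submodule.subtype_apply, LinearMap.toSpanSingleton_apply]
          rw [mul_smul, smul_comm x r u, hc r hr, smul_zero])
      have h2 : gam (maximalIdeal R) (LinearMap.range φ) = ⊤ :=
        gam_top_inj _ (LinearMap.range φ).subtype Subtype.val_injective h.tors
      obtain ⟨d, hd⟩ := fg_tors h2
      refine ⟨d + c, fun r hr => ?_⟩
      rw [pow_add] at hr
      refine Submodule.mul_induction_on hr ?_ ?_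
      · intro s hs t ht
        have := hd s hs ⟨φ ⟨t, ht⟩, ⟨_, rfl⟩⟩
        have := congrArg Subtype.val (congrArg Subtype.val this)
        rw [mul_smul]
        exact this
      · intro a b ha hb
        rw [add_smul, ha, hb, add_zero]
  exact ⟨h1, hom_finite (maximalIdeal R) (Ideal.span {x}) (by rwa [Ideal.span_singleton_le_iff_mem]) h1 h.fin⟩

end C3
end LCpf

namespace LCpf

section D0
lemma wb_top (j : ℕ) : (j : WithBot ℕ∞) < ((⊤ : ℕ∞) : WithBot ℕ∞) :=
  WithBot.coe_lt_coe.2 (ENat.natCast_lt_top j)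

lemma wb_top1 : ((⊤ : ℕ∞) : WithBot ℕ∞) + 1 = ((⊤ : ℕ∞) : WithBot ℕ∞) := rfl

lemma wb_le (d : WithBot ℕ∞) (j : ℕ) : d + 1 ≤ ((j + 1 : ℕ) : WithBot ℕ∞) ↔ d ≤ (j : WithBot ℕ∞) := by
  induction d with
  | bot => simp
  | coe d =>
    induction d with
    | top => 
      rw [wb_top1]
      exact ⟨fun h => absurd h (not_le.2 (wb_top _)), fun h => absurd h (not_le.2 (wb_top _))⟩
    | coe d =>
      norm_cast
      exact Nat.add_le_add_iff_right

lemma wb_lt (d : WithBot ℕ∞) (j : ℕ) : d + 1 < ((j + 1 : ℕ) : WithBot ℕ∞) ↔ d < (j : WithBot ℕ∞) := by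
  induction d with
  | bot => simp
  | coe d =>
    induction d with
    | top => 
      rw [wb_top1]
      exact ⟨fun h => absurd h (not_lt.2 (wb_top _).le), fun h => absurd h (not_lt.2 (wb_top _).le)⟩
    | coe d =>
      norm_cast
      exact Nat.add_lt_add_iff_right

lemma wb_eq (d : WithBot ℕ∞) (j : ℕ) : d + 1 = ((j + 1 : ℕ) : WithBot ℕ∞) ↔ d = (j : WithBot ℕ∞) := by
  rw [le_antisymm_iff, le_antisymm_iff, wb_le, ← not_lt (a := d + 1), wb_lt, not_lt]

lemma wb_lts (d : WithBot ℕ∞) (j : ℕ) : d < ((j + 1 : ℕ) : WithBot ℕ∞) ↔ d ≤ (j : WithBot ℕ∞) := by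
  induction d with
  | bot => simp
  | coe d =>
    induction d with
    | top => 
      exact ⟨fun h => absurd h (not_lt.2 (wb_top _).le), fun h => absurd h (not_le.2 (wb_top _))⟩
    | coe d =>
      norm_cast
      exact Nat.lt_succ_iff
end D0

set_option linter.unusedSectionVars false
section D1
variable {R : Type u} [CommRing R] [IsNoetherianRing R] [IsLocalRing R]
variable {M N L L' : Type u} [AddCommGroup M] [Module R M] [AddCommGroup L'] [Module R L']
 [AddCommGroup N] [Module R N] [AddCommGroup L] [Module R L]
variable {a : Ideal R}
open IsLocalRing
open scoped Pointwise

lemma exists_regular [Module.Finite R M] (h : gam a M = ⊥) : ∃ x ∈ a, IsSMulRegular M x := by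
  cases subsingleton_or_nontrivial M
  · exact ⟨0, zero_mem _, IsSMulRegular.zero⟩
  by_contra! hc
  obtain ⟨p, hp, hap⟩ : ∃ p ∈ associatedPrimes R M, a ≤ p := by
    obtain ⟨Ia, hIa⟩ := associatedPrimes.nonempty R M
    apply (Ideal.subset_union_prime_finite (associatedPrimes.finite R M) Ia Ia _).mp
    · rw [biUnion_associatedPrimes_eq_compl_regular R M]
      exact fun r hr ↦ hc r hr
    · exact fun I hin _ _ ↦ IsAssociatedPrime.isPrime hin
  obtain ⟨hpp, y, hy⟩ := isAssociatedPrime_iff.1 hp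
  have : y ∈ gam a M := ⟨1, fun r hr => by
    rw [pow_one] at hr
    have := hap hr
    rw [hy] at this
    simpa using this⟩
  rw [h, Submodule.mem_bot] at this
  subst this
  apply hpp.ne_top
  rw [hy]
  simp

lemma gam_quot [Module.Finite R M] : gam a (M ⧸ gam a M) = ⊥ := by
  rw [eq_bot_iff]
  intro y hy
  induction y using Submodule.Quotient.induction_on with | _ y =>
  obtain ⟨k, hk⟩ := hy
  have h1 : gam a (gam a M) = ⊤ := by
    rw [eq_top_iff]
    rintro ⟨z, c, hc⟩ -
    exact ⟨c, fun r hr => Subtype.ext (hc r hr)⟩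
  obtain ⟨c, hc⟩ := fg_tors h1
  rw [Submodule.mem_bot, Submodule.Quotient.mk_eq_zero]
  refine ⟨c + k, fun r hr => ?_⟩
  rw [pow_add] at hr
  refine Submodule.mul_induction_on hr ?_ ?_
  · intro s hs t ht
    have h2 := hk t ht
    rw [← Submodule.Quotient.mk_smul, Submodule.Quotient.mk_eq_zero] at h2
    rw [mul_smul]
    exact congrArg Subtype.val (hc s hs ⟨_, h2⟩)
  · intro u v hu hv
    rw [add_smul, hu, hv, add_zero]

lemma LC.map_mkQ_inj [Module.Finite R M] (i : ℕ) :
    Function.Injective (LC.map a (i+1) (gam a M).mkQ) := by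
  have h1 : gam a (gam a M) = ⊤ := by
    rw [eq_top_iff]
    rintro ⟨z, c, hc⟩ -
    exact ⟨c, fun r hr => Subtype.ext (hc r hr)⟩
  have := LC.tors_vanish (a := a) i (gam a M) h1
  have hex := LC.exact_mid (a := a) (i := i+1) (f := (gam a M).subtype) (g := (gam a M).mkQ)
    Subtype.val_injective (Submodule.mkQ_surjective _) (LinearMap.exact_subtype_mkQ _)
  rw [injective_iff_map_eq_zero]
  intro z hz
  obtain ⟨w, rfl⟩ := (hex z).1 hz
  rw [Subsingleton.elim w 0, _root_.map_zero]

lemma LC.map_lsmul (i : ℕ) (x : R) (z : LC a i M) : LC.map a i (x • (LinearMap.id : M →ₗ[R] M)) z = x • z := by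
  rw [LC.map_smul, LC.map_id]

lemma LC.sesx (i : ℕ) (x : R) (hx : IsSMulRegular M x) :
    ∃ δ : LC a i (QuotSMulTop x M) →ₗ[R] LC a (i+1) M,
      Function.Exact (LC.map a i (Submodule.mkQ (x • (⊤ : Submodule R M)))) δ ∧ ∀ z, x • z = 0 ↔ ∃ w, δ w = z := by
  obtain ⟨δ, h1, h2⟩ := LC.exists_δ (a := a) (i := i) (f := x • (LinearMap.id : M →ₗ[R] M))
    (g := Submodule.mkQ (x • (⊤ : Submodule R M))) hx (Submodule.mkQ_surjective _) (by
      intro y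
      simp [Submodule.mem_smul_pointwise_iff_exists])
  refine ⟨δ, h1, fun z => ?_⟩
  rw [← LC.map_lsmul]
  exact h2 z

lemma LC.sesx_mid (i : ℕ) (x : R) (hx : IsSMulRegular M x) (z : LC a i M) :
    LC.map a i (Submodule.mkQ (x • (⊤ : Submodule R M))) z = 0 ↔ ∃ w, x • w = z := by
  have h2 := LC.exact_mid (a := a) (i := i) (f := x • (LinearMap.id : M →ₗ[R] M))
    (g := Submodule.mkQ (x • (⊤ : Submodule R M))) hx (Submodule.mkQ_surjective _) (by
      intro y
      simp [Submodule.mem_smul_pointwise_iff_exists])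
  rw [h2 z]
  simp only [Set.mem_range, LC.map_lsmul]

lemma LC.subsing_zero [Subsingleton M] (i : ℕ) : Subsingleton (LC a i M) := by
  refine subsingleton_of_forall_eq 0 fun z => ?_
  rw [← LC.map_id z, show (LinearMap.id : M →ₗ[R] M) = 0 from Subsingleton.elim _ _, LC.map_zero]

lemma LC.xtors {i : ℕ} {x : R} (hx : x ∈ a) (z : LC a i M) : ∃ k : ℕ, x ^ k • z = 0 := by
  obtain ⟨k, hk⟩ := LC.torsion z
  exact ⟨k, hk _ (Ideal.pow_mem_pow hx k)⟩

lemma LC.vanish (ha : a ≤ maximalIdeal R) (i : ℕ) : ∀ (M : Type u) [AddCommGroup M] [Module R M] [Module.Finite R M],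
    Module.supportDim R M < (i : WithBot ℕ∞) → Subsingleton (LC a i M) := by
  induction i with
  | zero =>
    intro M _ _ _ h
    have : Subsingleton M := by
      rw [← Module.supportDim_eq_bot_iff_subsingleton R]
      by_contra hc
      obtain ⟨d, hd⟩ := WithBot.ne_bot_iff_exists.1 hc
      rw [← hd] at h
      exact absurd h (not_lt.2 (by exact_mod_cast zero_le))
    exact LC.subsing_zero 0
  | succ j ih =>
    intro M _ _ _ h
    have h1 := lt_of_le_of_lt (Module.supportDim_le_of_surjective (gam a M).mkQ (Submodule.mkQ_surjective _)) h
    obtain ⟨x, hxa, hx⟩ := exists_regular (gam_quot (a := a) (M := M))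
    rw [← Module.supportDim_quotSMulTop_succ_eq_supportDim hx (ha hxa), wb_lt] at h1
    have h2 := ih _ h1
    obtain ⟨δ, -, hδ⟩ := LC.sesx (a := a) j x hx
    have h3 : ∀ z : LC a (j+1) (M ⧸ gam a M), x • z = 0 → z = 0 := by
      intro z hz
      obtain ⟨w, rfl⟩ := (hδ z).1 hz
      rw [Subsingleton.elim w 0, _root_.map_zero]
    refine subsingleton_of_forall_eq 0 fun z => LC.map_mkQ_inj j ?_
    rw [_root_.map_zero]
    obtain ⟨k, hk⟩ := LC.xtors hxa (LC.map a (j+1) (gam a M).mkQ z)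
    generalize LC.map a (j+1) (gam a M).mkQ z = y at hk
    induction k generalizing y with
    | zero => simpa using hk
    | succ k ihk => 
      rw [pow_succ, mul_smul] at hk
      exact h3 _ (ihk _ hk)

lemma LC.map_surj (ha : a ≤ maximalIdeal R) (n : ℕ) [Module.Finite R N] (f : N →ₗ[R] M) (hf : Function.Surjective f)
    (hd : Module.supportDim R N ≤ (n : WithBot ℕ∞)) : Function.Surjective (LC.map a n f) := by
  have h1 : Module.supportDim R (LinearMap.ker f) < ((n + 1 : ℕ) : WithBot ℕ∞) := by
    rw [wb_lts]
    exact (Module.supportDim_le_of_injective (LinearMap.ker f).subtype Subtype.val_injective).trans hd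
  have := LC.vanish ha (n+1) _ h1
  obtain ⟨δ, h2, -⟩ := LC.exists_δ (a := a) (i := n) (f := (LinearMap.ker f).subtype) (g := f)
    Subtype.val_injective hf (LinearMap.exact_subtype_ker_map f)
  intro z
  exact (h2 z).1 (Subsingleton.elim _ _)

lemma dim_quot (p : Ideal R) [p.IsPrime] (n : ℕ) (hd : ringKrullDim (R ⧸ p) ≤ (n + 1 : ℕ)) (x : R) (hx : x ∉ p) :
    IsSMulRegular (R ⧸ p) x ∧ Module.supportDim R (QuotSMulTop x (R ⧸ p)) ≤ n := by
  refine ⟨?_, ?_⟩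
  · rw [isSMulRegular_iff_right_eq_zero_of_smul]
    intro y hy
    induction y using Submodule.Quotient.induction_on with | _ y =>
    rw [← Submodule.Quotient.mk_smul, Submodule.Quotient.mk_eq_zero] at hy
    rw [Submodule.Quotient.mk_eq_zero]
    exact (Ideal.IsPrime.mem_or_mem ‹_› hy).resolve_left hx
  · rw [← wb_le]
    refine (Module.supportDim_quotSMulTop_succ_le_of_notMem_minimalPrimes ?_).trans
      (by rwa [Module.supportDim_quotient_eq_ringKrullDim])
    rw [Ideal.annihilator_quotient, Ideal.minimalPrimes_eq_subsingleton_self]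
    rintro q rfl
    exact hx

lemma LC.div (ha : a ≤ maximalIdeal R) (n : ℕ) (p : Ideal R) [p.IsPrime] (hd : ringKrullDim (R ⧸ p) ≤ (n : WithBot ℕ∞))
    (x : R) (hx : x ∉ p) (z : LC a n (R ⧸ p)) : ∃ w, x • w = z := by
  have hreg : IsSMulRegular (R ⧸ p) x := (dim_quot p n (hd.trans (by exact_mod_cast Nat.le_succ n)) x hx).1
  have h1 : Module.supportDim R (QuotSMulTop x (R ⧸ p)) < n := by
    have : (Module.supportDim R (QuotSMulTop x (R ⧸ p))) + 1 ≤ n := by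
      refine (Module.supportDim_quotSMulTop_succ_le_of_notMem_minimalPrimes ?_).trans
        (by rwa [Module.supportDim_quotient_eq_ringKrullDim])
      rw [Ideal.annihilator_quotient, Ideal.minimalPrimes_eq_subsingleton_self]
      rintro q rfl
      exact hx
    rw [← wb_lt, wb_lts]
    exact this
  have := LC.vanish ha n _ h1
  rw [← LC.sesx_mid n x hreg]
  exact Subsingleton.elim _ _

end D1
end LCpf

namespace LCpf

set_option linter.unusedSectionVars false
section D2
variable {R : Type u} [CommRing R] [IsNoetherianRing R] [IsLocalRing R]
variable {M N L L' : Type u} [AddCommGroup M] [Module R M] [AddCommGroup L'] [Module R L']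
 [AddCommGroup N] [Module R N] [AddCommGroup L] [Module R L]
variable {a : Ideal R}
open IsLocalRing
open scoped Pointwise

lemma LC.ann_smul {i : ℕ} (r : R) (hr : ∀ m : M, r • m = 0) (z : LC a i M) : r • z = 0 := by
  rw [← LC.map_lsmul, show r • (LinearMap.id : M →ₗ[R] M) = 0 from LinearMap.ext hr, LC.map_zero]

lemma dim_zero_pow [Module.Finite R M] (h : Module.supportDim R M ≤ 0) : ∃ t : ℕ, maximalIdeal R ^ t ≤ Module.annihilator R M := by
  cases subsingleton_or_nontrivial M
  · exact ⟨0, fun r _ => Module.mem_annihilator.2 fun m => Subsingleton.elim _ _⟩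
  have h0 : Module.supportDim R M = 0 := by
    refine le_antisymm h ?_
    obtain ⟨d, hd⟩ := WithBot.ne_bot_iff_exists.1 (Module.supportDim_ne_bot_of_nontrivial R M)
    rw [← hd]
    exact_mod_cast zero_le
  have h1 := support_of_supportDim_eq_zero R M h0
  rw [Module.support_eq_zeroLocus] at h1
  refine Ideal.exists_pow_le_of_le_radical_of_fg ?_ (IsNoetherian.noetherian _)
  rw [← PrimeSpectrum.vanishingIdeal_zeroLocus_eq_radical, h1]
  exact PrimeSpectrum.subset_zeroLocus_iff_le_vanishingIdeal _ _ |>.1 le_rfl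

lemma supp_quot (I : Ideal R) (P : PrimeSpectrum R) : P ∈ Module.support R (R ⧸ I) ↔ I ≤ P.asIdeal := by
  rw [Module.support_eq_zeroLocus, Ideal.annihilator_quotient, PrimeSpectrum.mem_zeroLocus]
  rfl

lemma LC.kill (n : ℕ) (p' : Ideal R) [p'.IsPrime] (M : Type u) [AddCommGroup M] [Module R M] [hM : Module.Finite R M] :
    (∀ P : PrimeSpectrum R, P ∈ Module.support R M → ¬ P.asIdeal ≤ p' ∨ Subsingleton (LC a n (R ⧸ P.asIdeal))) →
    ∃ r, r ∉ p' ∧ ∀ z : LC a n M, r • z = 0 := by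
  induction hM using IsNoetherianRing.induction_on_isQuotientEquivQuotientPrime R with
  | subsingleton N =>
    intro _
    exact ⟨1, fun h => Ideal.IsPrime.ne_top ‹_› ((Ideal.eq_top_iff_one _).2 h),
      fun z => LC.ann_smul _ (fun m => Subsingleton.elim _ _) z⟩
  | quotient N p f =>
    intro h
    have hp : p ∈ Module.support R N := by
      rw [LinearEquiv.support_eq f, supp_quot]
    rcases h p hp with h | h
    · obtain ⟨r, hr, hr'⟩ := SetLike.not_le_iff_exists.1 h
      refine ⟨r, hr', fun z => LC.ann_smul _ (fun m => f.injective ?_) z⟩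
      rw [_root_.map_smul, _root_.map_zero]
      generalize f m = y
      induction y using Submodule.Quotient.induction_on with | _ y =>
      rw [← Submodule.Quotient.mk_smul, Submodule.Quotient.mk_eq_zero]
      exact Ideal.mul_mem_right _ _ hr
    · refine ⟨1, fun h => Ideal.IsPrime.ne_top ‹_› ((Ideal.eq_top_iff_one _).2 h), fun z => ?_⟩
      rw [one_smul, ← LC.map_id z, show (LinearMap.id : N →ₗ[R] N) = f.symm.toLinearMap ∘ₗ f.toLinearMap by ext; simp,
        LC.map_comp, Subsingleton.elim (LC.map a n f.toLinearMap z) 0, _root_.map_zero]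
  | exact N₁ N₂ N₃ f g hf hg hfg ih₁ ih₃ =>
    intro h
    obtain ⟨r₁, hr₁, hk₁⟩ := ih₁ fun P hP => h P (Module.support_subset_of_injective f hf hP)
    obtain ⟨r₃, hr₃, hk₃⟩ := ih₃ fun P hP => h P (Module.support_subset_of_surjective g hg hP)
    refine ⟨r₁ * r₃, fun h => ?_, fun z => ?_⟩
    · rcases Ideal.IsPrime.mem_or_mem ‹_› h with h | h
      exacts [hr₁ h, hr₃ h]
    · obtain ⟨w, hw⟩ := (LC.exact_mid (a := a) (i := n) hf hg hfg (r₃ • z)).1 (by rw [_root_.map_smul, hk₃])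
      rw [mul_smul, ← hw, ← _root_.map_smul, hk₁, _root_.map_zero]

variable [IsPrecomplete (maximalIdeal R) R] {E : Type u} [AddCommGroup E] [Module R E]

lemma LC.cof (hE : IsE R E) (ha : a ≤ maximalIdeal R) (i : ℕ) : ∀ (M : Type u) [AddCommGroup M] [Module R M] [Module.Finite R M],
    (Module.supportDim R M ≤ (i : WithBot ℕ∞) ∨ ∃ t : ℕ, maximalIdeal R ^ t ≤ a ⊔ Module.annihilator R M) →
    Cof R E (LC a i M) := by
  induction i with
  | zero =>
    intro M _ _ _ h
    have h' : ∃ t : ℕ, maximalIdeal R ^ t ≤ a ⊔ Module.annihilator R M := by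
      rcases h with h | h
      · obtain ⟨t, ht⟩ := dim_zero_pow (by simpa using h)
        exact ⟨t, ht.trans le_sup_right⟩
      · exact h
    obtain ⟨t, ht⟩ := h'
    have : Module.Finite R (LC a 0 M) := Module.Finite.of_injective (LC.ev a M) LC.ev_inj
    refine Cof.of_fg hE ?_
    rw [eq_top_iff]
    rintro z -
    obtain ⟨k, hk⟩ := LC.torsion z
    refine ⟨t * (k + 1), fun r hr => ?_⟩
    rw [pow_mul] at hr
    have h1 := Ideal.sup_pow_add_le_pow_sup_pow (Ideal.pow_right_mono ht (k+1) hr)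
    rw [pow_one] at h1
    obtain ⟨u, hu, v, hv, rfl⟩ := Submodule.mem_sup.1 h1
    rw [add_smul, hk u hu, LC.ann_smul v (Module.mem_annihilator.1 hv), add_zero]
  | succ j ih =>
    intro M _ _ _ h
    obtain ⟨x, hxa, hx⟩ := exists_regular (gam_quot (a := a) (M := M))
    have h2 : Cof R E (LC a j (QuotSMulTop x (M ⧸ gam a M))) := by
      apply ih
      rcases h with h | ⟨t, ht⟩
      · left
        rw [← wb_le, Module.supportDim_quotSMulTop_succ_eq_supportDim hx (ha hxa)]
        exact (Module.supportDim_le_of_surjective (gam a M).mkQ (Submodule.mkQ_surjective _)).trans h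
      · right
        refine ⟨t, ht.trans (sup_le_sup_left ?_ a)⟩
        exact (LinearMap.annihilator_le_of_surjective _ (Submodule.mkQ_surjective (gam a M))).trans
          (LinearMap.annihilator_le_of_surjective _ (Submodule.mkQ_surjective _))
    obtain ⟨δ, -, hδ⟩ := LC.sesx (a := a) j x hx
    refine Cof.of_inj hE _ (LC.map_mkQ_inj j) (Cof.of_ann hE x (ha hxa) (LC.xtors hxa) ?_)
    refine Cof.of_surj (δ.codRestrict _ (fun w => ?_)) ?_ h2
    · intro r hr
      obtain ⟨t, rfl⟩ := Ideal.mem_span_singleton'.1 hr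
      rw [mul_smul, (hδ _).2 ⟨w, rfl⟩, smul_zero]
    · rintro ⟨z, hz⟩
      obtain ⟨w, hw⟩ := (hδ z).1 (hz x (Ideal.mem_span_singleton_self x))
      exact ⟨w, Subtype.ext hw⟩

lemma LC.killK (ha : a ≤ maximalIdeal R) (n : ℕ) (p : Ideal R) [p.IsPrime] (hd : ringKrullDim (R ⧸ p) ≤ (n + 1 : ℕ))
    (x : R) (hx : x ∉ p) (p' : Ideal R) [p'.IsPrime] (hpp : p ≤ p') (hxp : x ∈ p') (r : R) (hr : r ∉ p')
    (hk : ∀ z : LC a n (QuotSMulTop x (R ⧸ p)), r • z = 0) : Subsingleton (LC a (n+1) (R ⧸ p)) := by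
  obtain ⟨E, _, _, hE1, e, he, hE2⟩ := exists_E R
  have hE : IsE R E := ⟨hE1, ⟨e, he⟩, hE2⟩
  have hC := LC.cof hE ha (n+1) (R ⧸ p) (Or.inl (by rwa [Module.supportDim_quotient_eq_ringKrullDim]))
  have hfin := hC.fin
  obtain ⟨δ, -, hδ⟩ := LC.sesx (a := a) n x (dim_quot p n hd x hx).1
  have h1 : ∀ f : LC a (n+1) (R ⧸ p) →ₗ[R] E, r • f ∈ Ideal.span {x} • (⊤ : Submodule R (LC a (n+1) (R ⧸ p) →ₗ[R] E)) := by
    intro f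
    refine hom_mem_smul _ _ fun u hu => ?_
    obtain ⟨w, rfl⟩ := (hδ u).1 (hu x (Ideal.mem_span_singleton_self x))
    rw [LinearMap.smul_apply, ← _root_.map_smul, ← _root_.map_smul, hk, _root_.map_zero, _root_.map_zero]
  obtain ⟨P, hP1, -, hP2, hP3⟩ := LinearMap.exists_monic_and_natDegree_eq_and_coeff_mem_pow_and_aeval_eq_zero R
    (algebraMap R (Module.End R (LC a (n+1) (R ⧸ p) →ₗ[R] E)) r) (Ideal.span {x}) (by
      rintro _ ⟨f, rfl⟩
      exact h1 f)
  rw [Polynomial.aeval_algebraMap_apply] at hP3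
  set r' := Polynomial.aeval r P with hr'
  have hr'p : r' ∉ p' := by
    rw [hr', Polynomial.aeval_def, Polynomial.eval₂_eq_sum_range, Finset.sum_range_succ, hP1.coeff_natDegree]
    intro h
    have h2 : ∑ k ∈ Finset.range P.natDegree, (algebraMap R R) (P.coeff k) * r ^ k ∈ p' := by
      refine Ideal.sum_mem _ fun k hk => Ideal.mul_mem_right _ _ ?_
      have h3 := Ideal.pow_le_self (Nat.sub_ne_zero_of_lt (Finset.mem_range.1 hk)) (hP2 k)
      exact (Ideal.span_singleton_le_iff_mem _).2 hxp h3
    rw [Ideal.add_mem_iff_right _ h2] at h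
    simp only [_root_.map_one, one_mul] at h
    exact hr (Ideal.IsPrime.mem_of_pow_mem ‹_› _ h)
  have h4 : ∀ u : LC a (n+1) (R ⧸ p), r' • u = 0 := by
    intro u
    refine faithful hE hC.tors _ fun f => ?_
    rw [_root_.map_smul]
    exact LinearMap.congr_fun (LinearMap.congr_fun hP3 f) u
  refine subsingleton_of_forall_eq 0 fun z => ?_
  obtain ⟨w, rfl⟩ := LC.div ha (n+1) p hd r' (fun h => hr'p (hpp h)) z
  exact h4 w

end D2
end LCpf

namespace LCpf

set_option linter.unusedSectionVars false
section D3
variable {R : Type u} [CommRing R] [IsNoetherianRing R] [IsLocalRing R]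
variable {M N L L' : Type u} [AddCommGroup M] [Module R M] [AddCommGroup L'] [Module R L']
 [AddCommGroup N] [Module R N] [AddCommGroup L] [Module R L]
variable {a : Ideal R}
open IsLocalRing
open scoped Pointwise

lemma exists_surj (p P : Ideal R) (h : p ≤ P) (x : R) (hx : x ∈ P) :
    ∃ f : QuotSMulTop x (R ⧸ p) →ₗ[R] (R ⧸ P), Function.Surjective f := by
  refine ⟨(x • (⊤ : Submodule R (R ⧸ p))).liftQ (Submodule.factor h) ?_, ?_⟩
  · intro y hy
    obtain ⟨z, -, rfl⟩ := (Submodule.mem_smul_pointwise_iff_exists _ _ _).1 hy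
    rw [LinearMap.mem_ker, map_smul]
    generalize Submodule.factor h z = w
    induction w using Submodule.Quotient.induction_on with | _ w =>
    rw [← Submodule.Quotient.mk_smul, Submodule.Quotient.mk_eq_zero]
    exact Ideal.mul_mem_right _ _ hx
  · intro y
    obtain ⟨z, hz⟩ := Submodule.factor_surjective h y
    exact ⟨Submodule.Quotient.mk z, hz⟩

lemma supp_quotx (p : Ideal R) (x : R) (P : PrimeSpectrum R) (h : P ∈ Module.support R (QuotSMulTop x (R ⧸ p))) :
    p ≤ P.asIdeal ∧ x ∈ P.asIdeal := by
  rw [Module.support_eq_zeroLocus, PrimeSpectrum.mem_zeroLocus] at h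
  constructor
  · intro r hr
    apply h
    rw [SetLike.mem_coe, Module.mem_annihilator]
    intro y
    obtain ⟨y, rfl⟩ := Submodule.mkQ_surjective _ y
    rw [← map_smul]
    induction y using Submodule.Quotient.induction_on with | _ y =>
    rw [← Submodule.Quotient.mk_smul, (Submodule.Quotient.mk_eq_zero p).2 (show r • y ∈ p from Ideal.mul_mem_right _ _ hr), map_zero]
  · apply h
    rw [SetLike.mem_coe, Module.mem_annihilator]
    intro y
    obtain ⟨y, rfl⟩ := Submodule.mkQ_surjective _ y
    rw [← map_smul, Submodule.mkQ_apply, Submodule.Quotient.mk_eq_zero]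
    exact Submodule.smul_mem_pointwise_smul _ _ _ trivial

lemma supp_dim (M : Type u) [AddCommGroup M] [Module R M] (P : PrimeSpectrum R) (h : P ∈ Module.support R M) :
    ringKrullDim (R ⧸ P.asIdeal) ≤ Module.supportDim R M := by
  rw [← Module.supportDim_quotient_eq_ringKrullDim]
  refine Order.krullDim_le_of_strictMono (fun q => ⟨q.1, ?_⟩) (fun {_ _} lt ↦ lt)
  exact Module.mem_support_mono ((supp_quot _ _).1 q.2) h

lemma exists_prime_dim (M : Type u) [AddCommGroup M] [Module R M] (k : ℕ) (h : Module.supportDim R M = (k : WithBot ℕ∞)) :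
    ∃ P ∈ Module.support R M, ringKrullDim (R ⧸ P.asIdeal) = (k : WithBot ℕ∞) := by
  obtain ⟨l, hl⟩ := Order.le_krullDim_iff.1 h.ge
  refine ⟨l.head.1, l.head.2, le_antisymm (h ▸ supp_dim M _ l.head.2) ?_⟩
  rw [← Module.supportDim_quotient_eq_ringKrullDim]
  refine Order.le_krullDim_iff.2 ⟨⟨l.length, fun i => ⟨(l i).1, (supp_quot _ _).2 (l.head_le i)⟩, fun i => l.step i⟩, hl⟩

lemma ann_pow [Module.Finite R M] (h : ∀ q ∈ associatedPrimes R M, maximalIdeal R ≤ q) :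
    ∃ t : ℕ, maximalIdeal R ^ t ≤ Module.annihilator R M := by
  refine Ideal.exists_pow_le_of_le_radical_of_fg ?_ (IsNoetherian.noetherian _)
  rw [← Ideal.sInf_minimalPrimes]
  exact le_sInf fun q hq => h q (Module.associatedPrimes.minimalPrimes_annihilator_subset_associatedPrimes R M hq)

lemma dim_pos (p : Ideal R) [p.IsPrime] (n : ℕ) (hd : ringKrullDim (R ⧸ p) = ((n + 1 : ℕ) : WithBot ℕ∞)) :
    ¬ maximalIdeal R ≤ p := by
  intro h
  have hp : p = maximalIdeal R := le_antisymm (le_maximalIdeal (Ideal.IsPrime.ne_top ‹_›)) h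
  subst hp
  have := ringKrullDim_eq_zero_of_isField (Ideal.Quotient.maximal_ideal_iff_isField_quotient _ |>.1 (maximalIdeal.isMaximal R))
  rw [this] at hd
  have hd' : (0 : ℕ) = n + 1 := by exact_mod_cast hd
  omega

lemma dim_zero (p : Ideal R) [p.IsPrime] (hd : ringKrullDim (R ⧸ p) = ((0 : ℕ) : WithBot ℕ∞)) :
    maximalIdeal R ≤ p := by
  obtain ⟨t, ht⟩ := dim_zero_pow (R := R) (M := R ⧸ p) (by rw [Module.supportDim_quotient_eq_ringKrullDim, hd]; exact le_rfl)
  rw [Ideal.annihilator_quotient] at ht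
  exact Ideal.IsPrime.le_of_pow_le ht

variable [IsPrecomplete (maximalIdeal R) R] 

lemma LC.nv (ha : a ≤ maximalIdeal R) (n : ℕ) : ∀ (p : Ideal R) [p.IsPrime], 
    ringKrullDim (R ⧸ p) = (n : WithBot ℕ∞) → (∃ t : ℕ, maximalIdeal R ^ t ≤ a ⊔ p) →
    ¬ Subsingleton (LC a n (R ⧸ p)) := by
  induction n with
  | zero =>
    intro p _ hd _ hs
    have hp := dim_zero p hd
    have h1 : (Submodule.Quotient.mk 1 : R ⧸ p) ∈ LinearMap.range (LC.ev a (R ⧸ p)) := by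
      rw [LC.range_ev]
      refine ⟨1, fun r hr => ?_⟩
      rw [pow_one] at hr
      rw [← Submodule.Quotient.mk_smul, Submodule.Quotient.mk_eq_zero]
      exact Ideal.mul_mem_right _ _ (hp (ha hr))
    obtain ⟨z, hz⟩ := h1
    rw [Subsingleton.elim z 0, _root_.map_zero] at hz
    have := (Submodule.Quotient.mk_eq_zero _).1 hz.symm
    exact Ideal.IsPrime.ne_top ‹_› ((Ideal.eq_top_iff_one _).2 this)
  | succ k ih =>
    rintro p _ hd ⟨t, ht⟩ hs
    have hpm := dim_pos p k hd
    have main : ∀ x ∈ maximalIdeal R, x ∉ p → ∃ P : PrimeSpectrum R, ringKrullDim (R ⧸ P.asIdeal) = (k : WithBot ℕ∞) ∧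
        ¬ Subsingleton (LC a k (R ⧸ P.asIdeal)) ∧
        ∃ g : LC a k (R ⧸ p) →ₗ[R] LC a k (R ⧸ P.asIdeal), Function.Surjective g ∧ ∀ z, g (x • z) = 0 := by
      intro x hxm hxp
      obtain ⟨hreg, hdx⟩ := dim_quot p k hd.le x hxp
      have hdx' : Module.supportDim R (QuotSMulTop x (R ⧸ p)) = k := by
        rw [← wb_eq, Module.supportDim_quotSMulTop_succ_eq_supportDim hreg hxm, Module.supportDim_quotient_eq_ringKrullDim, hd]
      obtain ⟨P, hP, hPd⟩ := exists_prime_dim _ k hdx'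
      obtain ⟨hpP, hxP⟩ := supp_quotx p x P hP
      obtain ⟨f, hf⟩ := exists_surj p P.asIdeal hpP x hxP
      obtain ⟨δ, hδ, -⟩ := LC.sesx (a := a) k x hreg
      refine ⟨P, hPd, ih _ hPd ⟨t, ht.trans (sup_le_sup_left hpP a)⟩, 
        LC.map a k f ∘ₗ LC.map a k (Submodule.mkQ _), ?_, ?_⟩
      · rw [LinearMap.coe_comp]
        refine (LC.map_surj ha k f hf hdx).comp fun z => (hδ z).1 (Subsingleton.elim _ _)
      · intro z
        rw [LinearMap.comp_apply, (LC.sesx_mid k x hreg (x • z)).2 ⟨z, rfl⟩, _root_.map_zero]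
    cases k with
    | zero =>
      obtain ⟨x, hxm, hxp⟩ := SetLike.not_le_iff_exists.1 hpm
      obtain ⟨P, -, hP, g, hg, -⟩ := main x hxm hxp
      apply hP
      have : Subsingleton (LC a 0 (R ⧸ p)) := by
        have hap : ¬ a ≤ p := fun h => hpm (Ideal.IsPrime.le_of_pow_le (ht.trans (sup_le h le_rfl)))
        obtain ⟨y, hya, hyp⟩ := SetLike.not_le_iff_exists.1 hap
        refine subsingleton_of_forall_eq 0 fun z => LC.ev_inj ?_
        rw [_root_.map_zero]
        obtain ⟨c, hc⟩ := LC.xtors hya z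
        have h5 : y ^ c • LC.ev a (R ⧸ p) z = 0 := by rw [← _root_.map_smul, hc, _root_.map_zero]
        generalize LC.ev a (R ⧸ p) z = w at h5
        induction w using Submodule.Quotient.induction_on with | _ w =>
        rw [← Submodule.Quotient.mk_smul, Submodule.Quotient.mk_eq_zero] at h5
        rw [Submodule.Quotient.mk_eq_zero]
        exact (Ideal.IsPrime.mem_or_mem ‹_› h5).resolve_left fun h => hyp (Ideal.IsPrime.mem_of_pow_mem ‹_› _ h)
      exact hg.subsingleton
    | succ k =>
      obtain ⟨E, _, _, hE1, e, he, hE2⟩ := exists_E R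
      have hE : IsE R E := ⟨hE1, ⟨e, he⟩, hE2⟩
      have hC := LC.cof hE ha (k+1) (R ⧸ p) (Or.inr ⟨t, by rwa [Ideal.annihilator_quotient]⟩)
      have hfin := hC.fin
      set V := LC a (k+1) (R ⧸ p) with hV
      have hex : ∃ x ∈ maximalIdeal R, x ∉ p ∧ ∀ q ∈ associatedPrimes R (V →ₗ[R] E), x ∈ q → maximalIdeal R ≤ q := by
        by_contra! hc
        have hfinS : (insert p {q ∈ associatedPrimes R (V →ₗ[R] E) | ¬ maximalIdeal R ≤ q}).Finite :=
          ((associatedPrimes.finite R (V →ₗ[R] E)).subset (fun q hq => hq.1)).insert p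
        obtain ⟨q, hq, hmq⟩ := (Ideal.subset_union_prime_finite (f := fun q => q) hfinS p p (I := maximalIdeal R) (by
          rintro q hq h -
          exact (Set.mem_of_mem_insert_of_ne hq h).1.isPrime)).1 (by
          intro x hx
          simp only [Set.mem_iUnion]
          by_cases hxp : x ∈ p
          · exact ⟨p, Set.mem_insert _ _, hxp⟩
          · obtain ⟨q, hq, hxq, hmq⟩ := hc x hx hxp
            exact ⟨q, Set.mem_insert_of_mem _ ⟨hq, hmq⟩, hxq⟩)
        rcases hq with rfl | hq
        · exact hpm hmq
        · exact hq.2 hmq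
      obtain ⟨x, hxm, hxp, hxq⟩ := hex
      obtain ⟨s, hs'⟩ := ann_pow (R := R) (M := ann0 (Ideal.span {x}) (V →ₗ[R] E)) (by
        intro q hq
        refine hxq q (associatedPrimes.subset_of_injective (f := (ann0 (Ideal.span {x}) (V →ₗ[R] E)).subtype) Subtype.val_injective hq) ?_
        obtain ⟨-, y, hy⟩ := isAssociatedPrime_iff.1 hq
        rw [hy]
        have : x • y = 0 := Subtype.ext (y.2 x (Ideal.mem_span_singleton_self x))
        simpa using this)
      have hVx : ∀ r ∈ maximalIdeal R ^ s, ∀ v : V, ∃ w : V, x • w = r • v := by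
        intro r hr v
        have h6 : (Submodule.mkQ (x • (⊤ : Submodule R V))) (r • v) = 0 := by
          refine faithful hE (gam_top_surj _ _ (Submodule.mkQ_surjective _) hC.tors) _ fun f => ?_
          have h7 : f ∘ₗ (Submodule.mkQ (x • (⊤ : Submodule R V))) ∈ ann0 (Ideal.span {x}) (V →ₗ[R] E) := by
            intro c hc
            obtain ⟨d, rfl⟩ := Ideal.mem_span_singleton'.1 hc
            ext v
            rw [LinearMap.smul_apply, ← _root_.map_smul, LinearMap.comp_apply, mul_comm, mul_smul,
              Submodule.mkQ_apply, (Submodule.Quotient.mk_eq_zero (x • (⊤ : Submodule R V))).2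
                (Submodule.smul_mem_pointwise_smul (d • v) x ⊤ Submodule.mem_top)]
            simp
          have h8 := Module.mem_annihilator.1 (hs' hr) ⟨_, h7⟩
          have h9 := LinearMap.congr_fun (congrArg Subtype.val h8) v
          rw [_root_.map_smul, _root_.map_smul]
          exact h9
        rw [Submodule.mkQ_apply, Submodule.Quotient.mk_eq_zero] at h6
        obtain ⟨w, -, hw⟩ := (Submodule.mem_smul_pointwise_iff_exists _ _ _).1 h6
        exact ⟨w, hw⟩
      obtain ⟨P, hPd, hP, g, hg, hgx⟩ := main x hxm hxp
      obtain ⟨y, hym, hyP⟩ := SetLike.not_le_iff_exists.1 (dim_pos P.asIdeal k hPd)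
      apply hP
      refine subsingleton_of_forall_eq 0 fun z => ?_
      obtain ⟨w, rfl⟩ := LC.div ha (k+1) P.asIdeal hPd.le (y ^ s) (fun h => hyP (Ideal.IsPrime.mem_of_pow_mem inferInstance _ h)) z
      obtain ⟨v, rfl⟩ := hg w
      obtain ⟨w', hw'⟩ := hVx _ (Ideal.pow_mem_pow hym s) v
      rw [← _root_.map_smul, ← hw', hgx]

lemma cat (n : ℕ) (p : Ideal R) [p.IsPrime] (hd : ringKrullDim (R ⧸ p) = ((n + 1 : ℕ) : WithBot ℕ∞)) (x : R)
    (hx : x ∉ p) (p' : Ideal R) (hp' : p' ∈ (p ⊔ Ideal.span {x}).minimalPrimes) :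
    ringKrullDim (R ⧸ p') = (n : WithBot ℕ∞) := by
  have : p'.IsPrime := hp'.1.1
  have hpp : p ≤ p' := le_sup_left.trans hp'.1.2
  have hxp : x ∈ p' := hp'.1.2 (le_sup_right (a := p) (Ideal.mem_span_singleton_self x))
  obtain ⟨hreg, hdx⟩ := dim_quot p n hd.le x hx
  obtain ⟨f, hf⟩ := exists_surj p p' hpp x hxp
  have hle : ringKrullDim (R ⧸ p') ≤ n := by
    rw [← Module.supportDim_quotient_eq_ringKrullDim]
    exact (Module.supportDim_le_of_surjective f hf).trans hdx
  by_contra hne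
  have hlt := lt_of_le_of_ne hle hne
  obtain ⟨r, hr, hk⟩ := LC.kill (a := maximalIdeal R) n p' (QuotSMulTop x (R ⧸ p)) (by
    intro P hP
    by_cases h : P.asIdeal ≤ p'
    · right
      obtain ⟨h1, h2⟩ := supp_quotx p x P hP
      have h3 : p' ≤ P.asIdeal := hp'.2 ⟨P.2, sup_le h1 ((Ideal.span_singleton_le_iff_mem _).2 h2)⟩ h
      have h4 : P.asIdeal = p' := le_antisymm h h3
      rw [h4]
      exact LC.vanish le_rfl n _ (by rwa [Module.supportDim_quotient_eq_ringKrullDim])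
    · exact Or.inl h)
  exact LC.nv le_rfl (n+1) p hd ⟨1, by rw [pow_one]; exact le_sup_left⟩
    (LC.killK le_rfl n p hd.le x hx p' hpp hxp r hr hk)

lemma LC.hlvt (ha : a ≤ maximalIdeal R) (Q : Ideal R) [Q.IsPrime] (haQ : a ≤ Q) (hQ : ¬ maximalIdeal R ≤ Q) (n : ℕ) : 
    ∀ (p : Ideal R) [p.IsPrime], ringKrullDim (R ⧸ p) = (n : WithBot ℕ∞) → p ≤ Q → Subsingleton (LC a n (R ⧸ p)) := by
  induction n with
  | zero =>
    intro p _ hd hpQ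
    exact absurd ((dim_zero p hd).trans hpQ) hQ
  | succ n ih =>
    intro p _ hd hpQ
    by_cases h : Q ≤ p
    · refine LC.tors_vanish n _ ?_
      rw [eq_top_iff]
      rintro y -
      induction y using Submodule.Quotient.induction_on with | _ y =>
      refine ⟨1, fun r hr => ?_⟩
      rw [pow_one] at hr
      rw [← Submodule.Quotient.mk_smul, Submodule.Quotient.mk_eq_zero]
      exact Ideal.mul_mem_right _ _ (h (haQ hr))
    · obtain ⟨x, hxQ, hxp⟩ := SetLike.not_le_iff_exists.1 h
      obtain ⟨p', hp', hp'Q⟩ := Ideal.exists_minimalPrimes_le (I := p ⊔ Ideal.span {x}) (J := Q)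
        (sup_le hpQ ((Ideal.span_singleton_le_iff_mem _).2 hxQ))
      have : p'.IsPrime := hp'.1.1
      have hpp : p ≤ p' := le_sup_left.trans hp'.1.2
      have hxp' : x ∈ p' := hp'.1.2 (le_sup_right (a := p) (Ideal.mem_span_singleton_self x))
      have hs := ih p' (cat n p hd x hxp p' hp') hp'Q
      obtain ⟨r, hr, hk⟩ := LC.kill (a := a) n p' (QuotSMulTop x (R ⧸ p)) (by
        intro P hP
        by_cases h : P.asIdeal ≤ p'
        · right
          obtain ⟨h1, h2⟩ := supp_quotx p x P hP
          have h3 : p' ≤ P.asIdeal := hp'.2 ⟨P.2, sup_le h1 ((Ideal.span_singleton_le_iff_mem _).2 h2)⟩ h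
          have h4 : P.asIdeal = p' := le_antisymm h h3
          rw [h4]
          exact hs
        · exact Or.inl h)
      exact LC.killK ha n p hd.le x hxp p' hpp hxp' r hr hk

end D3
end LCpf

namespace LCpf

set_option linter.unusedSectionVars false
section F
variable {R : Type u} [CommRing R] [IsNoetherianRing R] [IsLocalRing R]
variable {M N L L' : Type u} [AddCommGroup M] [Module R M] [AddCommGroup L'] [Module R L']
 [AddCommGroup N] [Module R N] [AddCommGroup L] [Module R L]
variable {a : Ideal R}
open IsLocalRing
open scoped Pointwise

lemma att_le (e : M ≃ₗ[R] N) : attachedPrimes R M ⊆ attachedPrimes R N := by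
  rintro p ⟨hp, K, hK⟩
  refine ⟨hp, K.map e.toLinearMap, ?_⟩
  rw [hK]
  exact LinearEquiv.annihilator_eq (Submodule.Quotient.equiv K _ e rfl)

lemma att_eq (e : M ≃ₗ[R] N) : attachedPrimes R M = attachedPrimes R N :=
  (att_le e).antisymm (att_le e.symm)

lemma dim_lt (q P : Ideal R) [q.IsPrime] (h : q ≤ P) (h' : ¬ P ≤ q) (k : ℕ)
    (hd : ringKrullDim (R ⧸ q) ≤ ((k + 1 : ℕ) : WithBot ℕ∞)) : ringKrullDim (R ⧸ P) ≤ (k : WithBot ℕ∞) := by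
  obtain ⟨x, hxP, hxq⟩ := SetLike.not_le_iff_exists.1 h'
  obtain ⟨f, hf⟩ := exists_surj q P h x hxP
  rw [← Module.supportDim_quotient_eq_ringKrullDim]
  exact (Module.supportDim_le_of_surjective f hf).trans (dim_quot q k hd x hxq).2

lemma dim_pi [Module.Finite R M] (S : Finset R) : Module.supportDim R (S → M) ≤ Module.supportDim R M := by
  have hsub : Module.support R (S → M) ⊆ Module.support R M := by
    rw [Module.support_eq_zeroLocus, Module.support_eq_zeroLocus]
    refine PrimeSpectrum.zeroLocus_anti_mono ?_
    intro r hr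
    rw [SetLike.mem_coe, Module.mem_annihilator] at hr ⊢
    intro f
    ext i
    exact hr (f i)
  exact Order.krullDim_le_of_strictMono (fun q => ⟨q.1, hsub q.2⟩) (fun {_ _} lt ↦ lt)

lemma att_sub (ha : a ≤ maximalIdeal R) (n : ℕ) [Module.Finite R M] (hd : Module.supportDim R M ≤ (n : WithBot ℕ∞))
    (P : PrimeSpectrum R) (K : Submodule R (LC a n M)) (hK : P.asIdeal = Module.annihilator R (LC a n M ⧸ K)) :
    P ∈ Module.support R M ∧ ringKrullDim (R ⧸ P.asIdeal) = (n : WithBot ℕ∞) ∧ ¬ Subsingleton (LC a n (R ⧸ P.asIdeal)) := by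
  classical
  obtain ⟨S, hS⟩ := (IsNoetherian.noetherian P.asIdeal : P.asIdeal.FG)
  let φ : (S → M) →ₗ[R] M := ∑ j : S, (j : R) • LinearMap.proj j
  have hφ : ∀ j : S, φ ∘ₗ LinearMap.single R (fun _ => M) j = (j : R) • LinearMap.id := by
    intro j
    ext m
    simp [φ, Pi.single_apply]
  by_cases hc : ∀ P' : PrimeSpectrum R, P' ∈ Module.support R (M ⧸ LinearMap.range φ) →
      ¬ P'.asIdeal ≤ P.asIdeal ∨ Subsingleton (LC a n (R ⧸ P'.asIdeal))
  · exfalso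
    obtain ⟨r, hr, hk⟩ := LC.kill n P.asIdeal _ hc
    apply hr
    rw [hK, Module.mem_annihilator]
    intro y
    obtain ⟨z, rfl⟩ := Submodule.mkQ_surjective _ y
    rw [← _root_.map_smul, Submodule.mkQ_apply, Submodule.Quotient.mk_eq_zero]
    have hex := LC.exact_mid (a := a) (i := n) (f := (LinearMap.range φ).subtype) (g := (LinearMap.range φ).mkQ)
      Subtype.val_injective (Submodule.mkQ_surjective _) (LinearMap.exact_subtype_mkQ _)
    obtain ⟨w, hw⟩ := (hex (r • z)).1 (by rw [_root_.map_smul, hk])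
    obtain ⟨w', rfl⟩ := LC.map_surj ha n φ.rangeRestrict φ.surjective_rangeRestrict ((dim_pi S).trans hd) w
    rw [← hw, ← LC.map_comp]
    have h1 : (LinearMap.range φ).subtype ∘ₗ φ.rangeRestrict = φ := rfl
    rw [h1]
    have h2 : ∀ T : Finset S, LC.map a n (∑ j ∈ T, (j : R) • (LinearMap.proj j : (S → M) →ₗ[R] M)) w' ∈ K := by
      intro T
      induction T using Finset.induction_on with
      | empty => rw [Finset.sum_empty, LC.map_zero]; exact zero_mem _
      | insert j T hj ih =>
        rw [Finset.sum_insert hj, LC.map_add, LC.map_smul]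
        refine add_mem ?_ ih
        have h3 : (j : R) ∈ P.asIdeal := hS ▸ Submodule.subset_span j.2
        rw [hK, Module.mem_annihilator] at h3
        have h4 := h3 (Submodule.Quotient.mk (LC.map a n (LinearMap.proj j : (S → M) →ₗ[R] M) w'))
        rwa [← Submodule.Quotient.mk_smul, Submodule.Quotient.mk_eq_zero] at h4
    exact h2 _
  · push Not at hc
    obtain ⟨P', hP', hle, hne⟩ := hc
    have hPP : P.asIdeal ≤ P'.asIdeal := by
      rw [Module.support_eq_zeroLocus, PrimeSpectrum.mem_zeroLocus] at hP'
      rw [← hS, Submodule.span_le]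
      intro j hj
      apply hP'
      rw [SetLike.mem_coe, Module.mem_annihilator]
      intro y
      obtain ⟨y, rfl⟩ := Submodule.mkQ_surjective _ y
      rw [← map_smul, Submodule.mkQ_apply, Submodule.Quotient.mk_eq_zero]
      exact ⟨_, LinearMap.congr_fun (hφ ⟨j, hj⟩) y⟩
    have hPe : P' = P := PrimeSpectrum.ext (le_antisymm hle hPP)
    subst hPe
    have hs := Module.support_subset_of_surjective _ (Submodule.mkQ_surjective (LinearMap.range φ)) hP'
    have hns : ¬ Subsingleton (LC a n (R ⧸ P'.asIdeal)) := not_subsingleton_iff_nontrivial.2 hne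
    refine ⟨hs, ?_, hns⟩
    by_contra hdd
    have hlt := lt_of_le_of_ne ((supp_dim M P' hs).trans hd) hdd
    exact hns (LC.vanish ha n _ (by rwa [Module.supportDim_quotient_eq_ringKrullDim]))

variable [IsPrecomplete (maximalIdeal R) R]

lemma att_sup (ha : a ≤ maximalIdeal R) (k : ℕ) [Module.Finite R M] (hd : Module.supportDim R M ≤ ((k + 1 : ℕ) : WithBot ℕ∞))
    (P : Ideal R) [hPp : P.IsPrime] (hP : Module.annihilator R M ≤ P) (hPd : ringKrullDim (R ⧸ P) = ((k + 1 : ℕ) : WithBot ℕ∞))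
    (ht : ∃ t : ℕ, maximalIdeal R ^ t ≤ a ⊔ P) : P ∈ attachedPrimes R (LC a (k+1) M) := by
  refine ⟨hPp, P • ⊤, le_antisymm ?_ ?_⟩
  · intro r hr
    rw [Module.mem_annihilator]
    intro y
    obtain ⟨z, rfl⟩ := Submodule.mkQ_surjective _ y
    rw [← _root_.map_smul, Submodule.mkQ_apply, Submodule.Quotient.mk_eq_zero]
    exact Submodule.smul_mem_smul hr trivial
  intro x hx
  by_contra hxP
  have hhom : ¬ Subsingleton (M →ₗ[R] R ⧸ P) := by
    rw [IsSMulRegular.subsingleton_linearMap_iff]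
    rintro ⟨r, hr, hreg⟩
    have h1 : (Submodule.Quotient.mk 1 : R ⧸ P) = 0 := by
      refine hreg ?_
      change r • _ = r • 0
      rw [smul_zero, ← Submodule.Quotient.mk_smul, Submodule.Quotient.mk_eq_zero]
      exact Ideal.mul_mem_right _ _ (hP hr)
    exact hPp.ne_top ((Ideal.eq_top_iff_one _).2 ((Submodule.Quotient.mk_eq_zero _).1 h1))
  obtain ⟨φ, hφ⟩ : ∃ φ : M →ₗ[R] R ⧸ P, φ ≠ 0 := by
    by_contra! h
    exact hhom (subsingleton_of_forall_eq 0 h)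
  obtain ⟨m, hm⟩ : ∃ m, φ m ≠ 0 := by
    by_contra! h
    exact hφ (LinearMap.ext h)
  obtain ⟨y, hy⟩ := Submodule.Quotient.mk_surjective P (φ m)
  have hyP : y ∉ P := fun h => hm (by rw [← hy]; exact (Submodule.Quotient.mk_eq_zero _).2 h)
  have hle : y • (⊤ : Submodule R (R ⧸ P)) ≤ LinearMap.range φ := by
    intro z hz
    obtain ⟨w, -, rfl⟩ := (Submodule.mem_smul_pointwise_iff_exists _ _ _).1 hz
    induction w using Submodule.Quotient.induction_on with | _ w =>
    refine ⟨w • m, ?_⟩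
    rw [_root_.map_smul, ← hy, ← Submodule.Quotient.mk_smul, ← Submodule.Quotient.mk_smul, smul_eq_mul, smul_eq_mul, mul_comm]
  have hcok : Subsingleton (LC a (k+1) ((R ⧸ P) ⧸ LinearMap.range φ)) := by
    refine LC.vanish ha (k+1) _ ?_
    rw [wb_lts]
    exact (Module.supportDim_le_of_surjective (Submodule.factor hle) (Submodule.factor_surjective hle)).trans
      (dim_quot P k hPd.le y hyP).2
  have hex := LC.exact_mid (a := a) (i := k+1) (f := (LinearMap.range φ).subtype) (g := (LinearMap.range φ).mkQ)
      Subtype.val_injective (Submodule.mkQ_surjective _) (LinearMap.exact_subtype_mkQ _)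
  have hs1 : Function.Surjective (LC.map a (k+1) (LinearMap.range φ).subtype) :=
    fun z => (hex z).1 (Subsingleton.elim _ _)
  have hs2 := LC.map_surj ha (k+1) φ.rangeRestrict φ.surjective_rangeRestrict hd
  let g : LC a (k+1) M →ₗ[R] LC a (k+1) (R ⧸ P) := LC.map a (k+1) (LinearMap.range φ).subtype ∘ₗ LC.map a (k+1) φ.rangeRestrict
  have hg : Function.Surjective g := by
    rw [LinearMap.coe_comp]
    exact hs1.comp hs2
  have hker : P • (⊤ : Submodule R (LC a (k+1) M)) ≤ LinearMap.ker g := by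
    rw [Submodule.smul_le]
    intro r hr z _
    rw [LinearMap.mem_ker, _root_.map_smul]
    refine LC.ann_smul r (fun w => ?_) _
    induction w using Submodule.Quotient.induction_on with | _ w =>
    rw [← Submodule.Quotient.mk_smul, Submodule.Quotient.mk_eq_zero]
    exact Ideal.mul_mem_right _ _ hr
  refine LC.nv ha (k+1) P hPd ht (subsingleton_of_forall_eq 0 fun z => ?_)
  obtain ⟨w, rfl⟩ := LC.div ha (k+1) P hPd.le x hxP z
  obtain ⟨v, rfl⟩ := hg w
  rw [← _root_.map_smul]
  apply hker
  have := Module.mem_annihilator.1 hx (Submodule.Quotient.mk v)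
  rwa [← Submodule.Quotient.mk_smul, Submodule.Quotient.mk_eq_zero] at this

end F
end LCpf

theorem stmt2 (R : Type u) [CommRing R] [IsNoetherianRing R] [IsLocalRing R]
    [IsAdicComplete (IsLocalRing.maximalIdeal R) R]
    (M : Type u) [AddCommGroup M] [Module R M] [Module.Finite R M]
    (n : ℕ) (hn : 1 ≤ n)
    (hdim : ringKrullDim (R ⧸ Module.annihilator R M) = (n : WithBot (WithTop ℕ)))
    (T : Set (Ideal R)) (hT : T ⊆ assh R M n) (hTne : T.Nonempty)
    (hTproper : T ≠ assh R M n)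
    (r : ℕ) (q : Fin r → Ideal R) (hq : assh R M n \ T = Set.range q)
    (Q : Fin r → PrimeSpectrum R)
    (hQsupp : ∀ i, Q i ∈ Module.support R M)
    (hQdim : ∀ i, ringKrullDim (R ⧸ (Q i).asIdeal) = (1 : WithBot (WithTop ℕ)))
    (hqQ : ∀ i, q i ≤ (Q i).asIdeal)
    (hTQ : ∀ i, ¬ sInf T ≤ (Q i).asIdeal) :
    attachedPrimes R
      ((localCohomology (⨅ i, (Q i).asIdeal) n).obj (ModuleCat.of R M)) = T := by
  obtain ⟨k, rfl⟩ : ∃ k, n = k + 1 := ⟨n - 1, by omega⟩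
  rw [LCpf.att_eq (LCpf.cmpEquiv (⨅ i, (Q i).asIdeal) k M)]
  have hsd : Module.supportDim R M = ((k + 1 : ℕ) : WithBot ℕ∞) := by
    rw [Module.supportDim_eq_ringKrullDim_quotient_annihilator]; exact hdim
  have hr : 0 < r := by
    rcases Nat.eq_zero_or_pos r with rfl | h
    · exfalso
      rw [Set.range_eq_empty, Set.sdiff_eq_empty] at hq
      exact hTproper (hT.antisymm hq)
    · exact h
  have ha : (⨅ i, (Q i).asIdeal) ≤ IsLocalRing.maximalIdeal R :=
    (iInf_le _ ⟨0, hr⟩).trans (IsLocalRing.le_maximalIdeal (Q ⟨0, hr⟩).2.ne_top)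
  apply Set.Subset.antisymm
  · rintro P ⟨hP, K, hK⟩
    obtain ⟨h1, h2, h3⟩ := LCpf.att_sub ha (k+1) hsd.le ⟨P, hP⟩ K hK
    have hann : Module.annihilator R M ≤ P := by
      rw [Module.support_eq_zeroLocus, PrimeSpectrum.mem_zeroLocus] at h1
      exact h1
    have hass : P ∈ assh R M (k+1) := by
      refine ⟨Module.associatedPrimes.minimalPrimes_annihilator_subset_associatedPrimes R M
        ⟨⟨hP, hann⟩, ?_⟩, h2⟩
      rintro p ⟨hp, hp'⟩ hpP
      by_contra hc
      have h4 : ringKrullDim (R ⧸ p) ≤ ((k + 1 : ℕ) : WithBot ℕ∞) := by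
        rw [← hsd]
        refine LCpf.supp_dim M ⟨p, hp⟩ ?_
        rw [Module.support_eq_zeroLocus, PrimeSpectrum.mem_zeroLocus]
        exact hp'
      have h5 := LCpf.dim_lt p P hpP hc k h4
      have h6 : ((k + 1 : ℕ) : WithBot ℕ∞) ≤ (k : WithBot ℕ∞) := h2 ▸ h5
      have h7 : k + 1 ≤ k := by exact_mod_cast h6
      omega
    by_contra hPT
    obtain ⟨i, rfl⟩ : P ∈ Set.range q := hq ▸ ⟨hass, hPT⟩
    exact h3 (LCpf.LC.hlvt ha (Q i).asIdeal (iInf_le _ i) (LCpf.dim_pos _ 0 (hQdim i)) (k+1) (q i) h2 (hqQ i))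
  · intro P hP
    obtain ⟨h1, h2⟩ := hT hP
    have hPp : P.IsPrime := h1.isPrime
    refine LCpf.att_sup ha k hsd.le P (by rw [← Submodule.annihilator_top]; exact h1.annihilator_le) h2 ?_
    refine Ideal.exists_pow_le_of_le_radical_of_fg ?_ (IsNoetherian.noetherian _)
    rw [Ideal.radical_eq_sInf]
    refine le_sInf ?_
    rintro p ⟨hp, hpp⟩
    obtain ⟨i, -, hi⟩ := (Ideal.IsPrime.inf_le' (s := Finset.univ) (f := fun i => (Q i).asIdeal) hpp).1 (by
      rw [Finset.inf_univ_eq_iInf]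
      exact le_sup_left.trans hp)
    have hne : ¬ p ≤ (Q i).asIdeal := fun h => hTQ i ((sInf_le hP).trans ((le_sup_right.trans hp).trans h))
    have h5 := LCpf.dim_lt (Q i).asIdeal p hi hne 0 (hQdim i).le
    exact LCpf.dim_zero p (le_antisymm h5 (by
      have := Ideal.Quotient.nontrivial_iff.2 hpp.ne_top
      exact ringKrullDim_nonneg_of_nontrivial))

end
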